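/- arXiv:1806.02600 — 13 statements merged into one kernel-verified Lean document; each statement's English description precedes it below -/
import Mathlib

section
/- Let d ≥ 1, α ∈ (-1,1), σ_Y > 0, c > 0, and θ, μ ∈ ℝ^d. Then the α-divergence loss of the N_d(μ, c²σ_Y² I_d) density as a predictive density for the N_d(θ, σ_Y² I_d) density equals (4/(1-α²)) · (1 − (2c^{1-α}/((1-α)c² + 1 + α))^{d/2} · exp(−‖μ − θ‖²/(2γ₀))), where γ₀ = 2(c²/(1+α) + 1/(1-α)) σ_Y². -/
open MeasureTheory Real

/-- Density of the `N_d(μ, v I_d)` distribution on `ℝ^d` (with `v` the variance). -/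
noncomputable def gaussPdf (d : ℕ) (μ : EuclideanSpace ℝ (Fin d)) (v : ℝ)
    (y : EuclideanSpace ℝ (Fin d)) : ℝ :=
  (2 * π * v) ^ (-(d : ℝ) / 2) * Real.exp (-‖y - μ‖ ^ 2 / (2 * v))

/-- The α-divergence loss of a predictive density `p` for a target density `q` on `ℝ^d`. -/
noncomputable def alphaLoss (d : ℕ) (α : ℝ) (q p : EuclideanSpace ℝ (Fin d) → ℝ) : ℝ :=
  ∫ y, (4 / (1 - α ^ 2)) * (1 - (p y / q y) ^ ((1 + α) / 2)) * q y

theorem gauss_int (d : ℕ) (m : EuclideanSpace ℝ (Fin d)) (b : ℝ) (hb : 0 < b) :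
    Integrable (fun y : EuclideanSpace ℝ (Fin d) => Real.exp (-b * ‖y - m‖ ^ 2)) ∧
    ∫ y : EuclideanSpace ℝ (Fin d), Real.exp (-b * ‖y - m‖ ^ 2)
      = Real.exp (Real.log (π / b) * ((d : ℝ) / 2)) := by
  have h : ∫ y : EuclideanSpace ℝ (Fin d), Real.exp (-b * ‖y - m‖ ^ 2)
      = Real.exp (Real.log (π / b) * ((d : ℝ) / 2)) := by
    rw [integral_sub_right_eq_self (fun y : EuclideanSpace ℝ (Fin d) => Real.exp (-b * ‖y‖ ^ 2)) m,
      GaussianFourier.integral_rexp_neg_mul_sq_norm hb, Real.rpow_def_of_pos (by positivity)]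
    simp
  refine ⟨?_, h⟩
  by_contra hn
  rw [integral_undef hn] at h
  exact (Real.exp_pos _).ne h

theorem complete_sq (d : ℕ) (μ θ y : EuclideanSpace ℝ (Fin d)) (a b : ℝ) (hab : 0 < a + b) :
    a * ‖y - μ‖ ^ 2 + b * ‖y - θ‖ ^ 2 =
      (a + b) * ‖y - ((a / (a + b)) • μ + (b / (a + b)) • θ)‖ ^ 2
        + a * b / (a + b) * ‖μ - θ‖ ^ 2 := by
  simp only [EuclideanSpace.norm_sq_eq, Finset.mul_sum, ← Finset.sum_add_distrib]
  refine Finset.sum_congr rfl fun i _ => ?_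
  simp only [PiLp.sub_apply, PiLp.add_apply, PiLp.smul_apply, smul_eq_mul, Real.norm_eq_abs, sq_abs]
  field_simp
  ring

theorem gaussPdf_exp (d : ℕ) (μ y : EuclideanSpace ℝ (Fin d)) (v : ℝ) (hv : 0 < v) :
    gaussPdf d μ v y =
      Real.exp (Real.log (2 * π * v) * (-(d : ℝ) / 2) + -‖y - μ‖ ^ 2 / (2 * v)) := by
  rw [gaussPdf, Real.rpow_def_of_pos (by positivity), Real.exp_add]

theorem stmt0 (d : ℕ) (hd : 1 ≤ d) (α : ℝ) (hα : α ∈ Set.Ioo (-1 : ℝ) 1)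
    (σY c : ℝ) (hσY : 0 < σY) (hc : 0 < c)
    (θ μ : EuclideanSpace ℝ (Fin d))
    (γ₀ : ℝ) (hγ₀ : γ₀ = 2 * (c ^ 2 / (1 + α) + 1 / (1 - α)) * σY ^ 2) :
    alphaLoss d α (gaussPdf d θ (σY ^ 2)) (gaussPdf d μ (c ^ 2 * σY ^ 2)) =
      (4 / (1 - α ^ 2)) *
        (1 - (2 * c ^ (1 - α) / ((1 - α) * c ^ 2 + 1 + α)) ^ ((d : ℝ) / 2) *
            Real.exp (-‖μ - θ‖ ^ 2 / (2 * γ₀))) := by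
  obtain ⟨h1, h2⟩ := hα
  have hp : 0 < 1 + α := by linarith
  have hm : 0 < 1 - α := by linarith
  set D : ℝ := (1 - α) * c ^ 2 + 1 + α with hD
  have hDpos : 0 < D := by rw [hD]; nlinarith [mul_pos hm (pow_pos hc 2)]
  set a : ℝ := (1 + α) / (4 * (c ^ 2 * σY ^ 2)) with ha
  set b : ℝ := (1 - α) / (4 * σY ^ 2) with hb
  have hapos : 0 < a := by positivity
  have hbpos : 0 < b := by positivity
  have hab : 0 < a + b := by positivity
  have habD : a + b = D / (4 * (c ^ 2 * σY ^ 2)) := by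
    rw [ha, hb, hD]; field_simp; ring
  set m := (a / (a + b)) • μ + (b / (a + b)) • θ with hmdef
  set K : ℝ := (2 * c ^ (1 - α) / D) ^ ((d : ℝ) / 2) * Real.exp (-‖μ - θ‖ ^ 2 / (2 * γ₀)) with hK
  have hv : 0 < σY ^ 2 := by positivity
  have hv' : 0 < c ^ 2 * σY ^ 2 := by positivity
  obtain ⟨qi, qI⟩ := gauss_int d θ (1 / (2 * σY ^ 2)) (by positivity)
  obtain ⟨ri, rI⟩ := gauss_int d m (a + b) hab
  have hq : ∀ y, gaussPdf d θ (σY ^ 2) y =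
      Real.exp (Real.log (2 * π * σY ^ 2) * (-(d : ℝ) / 2)) *
        Real.exp (-(1 / (2 * σY ^ 2)) * ‖y - θ‖ ^ 2) := by
    intro y
    rw [gaussPdf_exp d θ y _ hv, Real.exp_add]
    congr 2
    ring
  have hγ : a * b / (a + b) = 1 / (2 * γ₀) := by
    have : 2 * γ₀ = D * (4 * σY ^ 2) / ((1 + α) * (1 - α)) := by
      rw [hγ₀, hD]; field_simp; ring
    rw [habD, this, ha, hb]
    field_simp
  have hr : ∀ y, (gaussPdf d μ (c ^ 2 * σY ^ 2) y / gaussPdf d θ (σY ^ 2) y) ^ ((1 + α) / 2)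
        * gaussPdf d θ (σY ^ 2) y =
      K * Real.exp (-(Real.log (π / (a + b)) * ((d : ℝ) / 2))) *
        Real.exp (-(a + b) * ‖y - m‖ ^ 2) := by
    intro y
    have hs := complete_sq d μ θ y a b hab
    rw [← hmdef, hγ] at hs
    rw [hK, gaussPdf_exp d θ y _ hv, gaussPdf_exp d μ y _ hv', ← Real.exp_sub, ← Real.exp_mul,
      Real.rpow_def_of_pos (by positivity), ← Real.exp_add, ← Real.exp_add, ← Real.exp_add,
      ← Real.exp_add]
    congr 1
    have e1 : -(a + b) * ‖y - m‖ ^ 2 =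
        -(a * ‖y - μ‖ ^ 2 + b * ‖y - θ‖ ^ 2) + 1 / (2 * γ₀) * ‖μ - θ‖ ^ 2 := by linarith
    have l1 : Real.log (2 * c ^ (1 - α) / D) = Real.log 2 + (1 - α) * Real.log c - Real.log D := by
      rw [Real.log_div (by positivity) hDpos.ne', Real.log_mul (by norm_num) (by positivity),
        Real.log_rpow hc]
    have l2 : Real.log (π / (a + b)) =
        Real.log π + (2 * Real.log 2 + (2 * Real.log c + Real.log (σY ^ 2))) - Real.log D := by
      have : π / (a + b) = π * (2 ^ 2 * (c ^ 2 * σY ^ 2)) / D := by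
        rw [habD]; field_simp; norm_num
      rw [this, Real.log_div (by positivity) hDpos.ne', Real.log_mul (by positivity) (by positivity),
        Real.log_mul (by positivity) (by positivity), Real.log_mul (by positivity) (by positivity),
        Real.log_pow, Real.log_pow]
      push_cast
      ring
    have l3 : Real.log (2 * π * σY ^ 2) = Real.log 2 + Real.log π + Real.log (σY ^ 2) := by
      rw [Real.log_mul (by positivity) (by positivity), Real.log_mul (by positivity) (by positivity)]
    have l4 : Real.log (2 * π * (c ^ 2 * σY ^ 2)) =
        Real.log 2 + Real.log π + (2 * Real.log c + Real.log (σY ^ 2)) := by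
      rw [Real.log_mul (by positivity) (by positivity), Real.log_mul (by positivity) (by positivity),
        Real.log_mul (by positivity) (by positivity), Real.log_pow]
      push_cast
      ring
    rw [e1, l1, l2, l3, l4, ha, hb]
    generalize Real.log (σY ^ 2) = L
    have e2 : -‖y - μ‖ ^ 2 / (2 * (c ^ 2 * σY ^ 2)) * ((1 + α) / 2) =
      -((1 + α) / (4 * (c ^ 2 * σY ^ 2)) * ‖y - μ‖ ^ 2) := by field_simp; norm_num
    have e3 : -‖y - θ‖ ^ 2 / (2 * σY ^ 2) * ((1 - α) / 2) =
      -((1 - α) / (4 * σY ^ 2) * ‖y - θ‖ ^ 2) := by field_simp; norm_num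
    have e4 : -‖μ - θ‖ ^ 2 / (2 * γ₀) = -(1 / (2 * γ₀) * ‖μ - θ‖ ^ 2) := by ring
    rw [e4]
    linear_combination e2 + e3
  have hfun : ∀ y, (4 / (1 - α ^ 2)) *
      (1 - (gaussPdf d μ (c ^ 2 * σY ^ 2) y / gaussPdf d θ (σY ^ 2) y) ^ ((1 + α) / 2))
        * gaussPdf d θ (σY ^ 2) y =
      (4 / (1 - α ^ 2)) * (Real.exp (Real.log (2 * π * σY ^ 2) * (-(d : ℝ) / 2)) *
        Real.exp (-(1 / (2 * σY ^ 2)) * ‖y - θ‖ ^ 2) -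
        K * Real.exp (-(Real.log (π / (a + b)) * ((d : ℝ) / 2))) *
        Real.exp (-(a + b) * ‖y - m‖ ^ 2)) := by
    intro y
    rw [← hr y, ← hq y]
    ring
  rw [alphaLoss]
  simp_rw [hfun]
  rw [integral_const_mul, integral_sub (qi.const_mul _) (ri.const_mul _), integral_const_mul,
    integral_const_mul, qI, rI, mul_assoc K, ← Real.exp_add, ← Real.exp_add]
  have hz : π / (1 / (2 * σY ^ 2)) = 2 * π * σY ^ 2 := by field_simp
  rw [hz, neg_add_cancel, Real.exp_zero, mul_one]
  congr 2
  rw [← Real.exp_zero]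
  congr 1
  ring
end

section
/- Let d ≥ 1, α ∈ (-1,1), σ_X, σ_Y > 0, r = σ_X²/σ_Y², a ∈ ℝ, c > 0, and θ̂_a(X) = aX. Then for every θ ∈ ℝ^d, R_α(θ, q_{θ̂_a,c}) = (4/(1-α²)) · (1 − (4c^{1-α}/(2c²(1-α) + 2(1+α) + a²(1-α²)r))^{d/2} · exp(−(a−1)²‖θ‖²/(2(γ₀ + a²σ_X²)))), where γ₀ = 2σ_Y²(c²(1-α) + 1 + α)/(1-α²). -/
open MeasureTheory Real

/-- Frequentist α-divergence risk of the predictive density `N_d(θhat X, c²σ_Y² I_d)`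
for the target `N_d(θ, σ_Y² I_d)`, with `X ~ N_d(θ, σ_X² I_d)`. -/
noncomputable def alphaRisk (d : ℕ) (α σX σY : ℝ)
    (θhat : EuclideanSpace ℝ (Fin d) → EuclideanSpace ℝ (Fin d)) (c : ℝ)
    (θ : EuclideanSpace ℝ (Fin d)) : ℝ :=
  ∫ x, gaussPdf d θ (σX ^ 2) x *
    alphaLoss d α (gaussPdf d θ (σY ^ 2)) (gaussPdf d (θhat x) (c ^ 2 * σY ^ 2))

lemma aux_sq {d : ℕ} (A B a : ℝ) (hD : A + B * a ^ 2 ≠ 0) (y m n : EuclideanSpace ℝ (Fin d)) :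
    A * ‖y - m‖ ^ 2 + B * ‖a • y - n‖ ^ 2 =
      (A + B * a ^ 2) * ‖y - (A + B * a ^ 2)⁻¹ • (A • m + (a * B) • n)‖ ^ 2
        + A * B / (A + B * a ^ 2) * ‖a • m - n‖ ^ 2 := by
  simp only [EuclideanSpace.norm_sq_eq, Finset.mul_sum, ← Finset.sum_add_distrib]
  refine Finset.sum_congr rfl fun i _ => ?_
  simp only [Real.norm_eq_abs, sq_abs, PiLp.sub_apply, PiLp.add_apply, PiLp.smul_apply, smul_eq_mul]
  field_simp
  ring

lemma aux_int0 {d : ℕ} (b : ℝ) (hb : 0 < b) :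
    Integrable (fun y : EuclideanSpace ℝ (Fin d) => Real.exp (-b * ‖y‖ ^ 2)) := by
  by_contra h
  have h1 := GaussianFourier.integral_rexp_neg_mul_sq_norm (V := EuclideanSpace ℝ (Fin d)) hb
  rw [integral_undef h] at h1
  have : 0 < (π / b) ^ ((Module.finrank ℝ (EuclideanSpace ℝ (Fin d)) : ℝ) / 2) := by positivity
  linarith

lemma aux_gauss {d : ℕ} (A B a : ℝ) (hA : 0 < A) (hB : 0 ≤ B) (m n : EuclideanSpace ℝ (Fin d)) :
    Integrable (fun y : EuclideanSpace ℝ (Fin d) =>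
      Real.exp (-(A * ‖y - m‖ ^ 2 + B * ‖a • y - n‖ ^ 2))) ∧
    ∫ y : EuclideanSpace ℝ (Fin d), Real.exp (-(A * ‖y - m‖ ^ 2 + B * ‖a • y - n‖ ^ 2)) =
      (π / (A + B * a ^ 2)) ^ ((d : ℝ) / 2) *
        Real.exp (-(A * B / (A + B * a ^ 2) * ‖a • m - n‖ ^ 2)) := by
  have hD : 0 < A + B * a ^ 2 := by positivity
  have h : (fun y : EuclideanSpace ℝ (Fin d) =>
      Real.exp (-(A * ‖y - m‖ ^ 2 + B * ‖a • y - n‖ ^ 2))) = fun y =>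
      Real.exp (-(A + B * a ^ 2) * ‖y - (A + B * a ^ 2)⁻¹ • (A • m + (a * B) • n)‖ ^ 2) *
        Real.exp (-(A * B / (A + B * a ^ 2) * ‖a • m - n‖ ^ 2)) := by
    funext y
    rw [aux_sq A B a hD.ne', ← Real.exp_add]
    congr 1
    ring
  rw [h]
  constructor
  · exact ((aux_int0 _ hD).comp_sub_right _).mul_const _
  · rw [integral_mul_const, integral_sub_right_eq_self
      (fun y : EuclideanSpace ℝ (Fin d) => Real.exp (-(A + B * a ^ 2) * ‖y‖ ^ 2)),
      GaussianFourier.integral_rexp_neg_mul_sq_norm hD]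
    simp

lemma aux_pdf {d : ℕ} (v : ℝ) (hv : 0 < v) (m : EuclideanSpace ℝ (Fin d)) :
    Integrable (gaussPdf d m v) ∧ ∫ y, gaussPdf d m v y = 1 := by
  have h := aux_gauss (1 / (2 * v)) 0 0 (by positivity) le_rfl m m
  have e : gaussPdf d m v = fun y => (2 * π * v) ^ (-(d : ℝ) / 2) *
      Real.exp (-(1 / (2 * v) * ‖y - m‖ ^ 2 + 0 * ‖(0 : ℝ) • y - m‖ ^ 2)) := by
    funext y
    rw [gaussPdf]
    congr 2
    ring
  rw [e]
  refine ⟨h.1.const_mul _, ?_⟩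
  rw [integral_const_mul, h.2]
  have : π / (1 / (2 * v) + 0 * 0 ^ 2) = 2 * π * v := by field_simp; ring
  rw [this, neg_div, Real.rpow_neg (by positivity)]
  have : 0 < (2 * π * v) ^ ((d : ℝ) / 2) := by positivity
  simp
  field_simp

lemma aux_loss {d : ℕ} (α s c : ℝ) (hα : α ∈ Set.Ioo (-1 : ℝ) 1) (hs : 0 < s) (hc : 0 < c)
    (m θ : EuclideanSpace ℝ (Fin d)) :
    alphaLoss d α (gaussPdf d θ s) (gaussPdf d m (c ^ 2 * s)) =
      (4 / (1 - α ^ 2)) * (1 - (2 * c ^ (1 - α) / (c ^ 2 * (1 - α) + 1 + α)) ^ ((d : ℝ) / 2) *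
        Real.exp (-((1 - α ^ 2) / (4 * s * (c ^ 2 * (1 - α) + 1 + α)) * ‖m - θ‖ ^ 2))) := by
  obtain ⟨h1, h2⟩ := hα
  have h1' : 0 < 1 + α := by linarith
  have h2' : 0 < 1 - α := by linarith
  have hK : 0 < c ^ 2 * (1 - α) + 1 + α := by
    have : 0 < c ^ 2 * (1 - α) := by positivity
    linarith
  have hg := aux_gauss ((1 + α) / (4 * c ^ 2 * s)) ((1 - α) / (4 * s)) 1 (by positivity)
    (by positivity) m θ
  have hp := aux_pdf s hs θ
  have e : ∀ y, (4 / (1 - α ^ 2)) * (1 - (gaussPdf d m (c ^ 2 * s) y / gaussPdf d θ s y) ^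
      ((1 + α) / 2)) * gaussPdf d θ s y = (4 / (1 - α ^ 2)) * (gaussPdf d θ s y -
        (c ^ (-(1 + α)) * (2 * π * s)⁻¹) ^ ((d : ℝ) / 2) *
        Real.exp (-((1 + α) / (4 * c ^ 2 * s) * ‖y - m‖ ^ 2 +
          (1 - α) / (4 * s) * ‖(1 : ℝ) • y - θ‖ ^ 2))) := by
    intro y
    rw [mul_assoc, sub_mul, one_mul]
    congr 2
    have hq : 0 < 2 * π * s := by positivity
    have hcs : 0 < 2 * π * (c ^ 2 * s) := by positivity
    unfold gaussPdf
    rw [mul_div_mul_comm, ← Real.exp_sub, ← Real.div_rpow hcs.le hq.le,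
      Real.mul_rpow (by positivity) (by positivity), ← Real.exp_mul]
    have : 2 * π * (c ^ 2 * s) / (2 * π * s) = c ^ (2 : ℝ) := by
      rw [Real.rpow_two]; field_simp
    have e3 : (c ^ (-(1 + α)) * (2 * π * s)⁻¹) ^ ((d : ℝ) / 2) =
        c ^ (-(1 + α) * ((d : ℝ) / 2)) * (2 * π * s) ^ (-(d : ℝ) / 2) := by
      rw [Real.mul_rpow (by positivity) (by positivity), Real.inv_rpow hq.le,
        ← Real.rpow_neg hq.le, ← Real.rpow_mul hc.le, neg_div]
    rw [this, e3, ← Real.rpow_mul hc.le, ← Real.rpow_mul hc.le]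
    rw [mul_mul_mul_comm, ← Real.exp_add]
    congr 1
    · congr 2
      ring
    · congr 1
      rw [one_smul]
      field_simp
      ring
  unfold alphaLoss
  simp only [e]
  rw [integral_const_mul, integral_sub hp.1 (hg.1.const_mul _), hp.2, integral_const_mul, hg.2,
    ← mul_assoc, ← Real.mul_rpow (by positivity) (by positivity), one_smul]
  have ec : c ^ (-(1 + α)) = c ^ (1 - α) / c ^ 2 := by
    rw [← Real.rpow_two, ← Real.rpow_sub hc]
    congr 1; ring
  have hS : (1 + α) / (4 * c ^ 2 * s) + (1 - α) / (4 * s) * 1 ^ 2 =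
      (c ^ 2 * (1 - α) + 1 + α) / (4 * c ^ 2 * s) := by field_simp; ring
  rw [hS, ec]
  congr 4
  · field_simp
    ring
  · field_simp
    ring

theorem stmt2 (d : ℕ) (hd : 1 ≤ d) (α : ℝ) (hα : α ∈ Set.Ioo (-1 : ℝ) 1)
    (σX σY : ℝ) (hσX : 0 < σX) (hσY : 0 < σY)
    (r : ℝ) (hr : r = σX ^ 2 / σY ^ 2) (a c : ℝ) (hc : 0 < c)
    (γ₀ : ℝ) (hγ₀ : γ₀ = 2 * σY ^ 2 * (c ^ 2 * (1 - α) + 1 + α) / (1 - α ^ 2))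
    (θ : EuclideanSpace ℝ (Fin d)) :
    alphaRisk d α σX σY (fun x => a • x) c θ =
      (4 / (1 - α ^ 2)) *
        (1 - (4 * c ^ (1 - α) /
              (2 * c ^ 2 * (1 - α) + 2 * (1 + α) + a ^ 2 * (1 - α ^ 2) * r)) ^ ((d : ℝ) / 2) *
            Real.exp (-((a - 1) ^ 2 * ‖θ‖ ^ 2) / (2 * (γ₀ + a ^ 2 * σX ^ 2)))) := by
  have h1' : 0 < 1 + α := by linarith [hα.1]
  have h2' : 0 < 1 - α := by linarith [hα.2]
  have hα2 : 0 < 1 - α ^ 2 := by nlinarith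
  have hK : 0 < c ^ 2 * (1 - α) + 1 + α := by
    have : 0 < c ^ 2 * (1 - α) := by positivity
    linarith
  have hγ : 0 < γ₀ := by rw [hγ₀]; positivity
  have hX : 0 < 2 * π * σX ^ 2 := by positivity
  have hp := aux_pdf (σX ^ 2) (by positivity) θ
  have hg := aux_gauss (1 / (2 * σX ^ 2)) (1 / (2 * γ₀)) a (by positivity) (by positivity) θ θ
  unfold alphaRisk
  have e : ∀ x, gaussPdf d θ (σX ^ 2) x * alphaLoss d α (gaussPdf d θ (σY ^ 2))
      (gaussPdf d (a • x) (c ^ 2 * σY ^ 2)) = (4 / (1 - α ^ 2)) * (gaussPdf d θ (σX ^ 2) x -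
      ((2 * c ^ (1 - α) / (c ^ 2 * (1 - α) + 1 + α)) * (2 * π * σX ^ 2)⁻¹) ^ ((d : ℝ) / 2) *
      Real.exp (-(1 / (2 * σX ^ 2) * ‖x - θ‖ ^ 2 + 1 / (2 * γ₀) * ‖a • x - θ‖ ^ 2))) := by
    intro x
    rw [aux_loss α _ c hα (by positivity) hc, mul_left_comm, mul_sub, mul_one]
    congr 2
    have e3 : ∀ z : ℝ, 0 ≤ z → (z * (2 * π * σX ^ 2)⁻¹) ^ ((d : ℝ) / 2) =
        z ^ ((d : ℝ) / 2) * (2 * π * σX ^ 2) ^ (-(d : ℝ) / 2) := by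
      intro z hz
      rw [Real.mul_rpow hz (by positivity), Real.inv_rpow hX.le, ← Real.rpow_neg hX.le, neg_div]
    rw [gaussPdf, e3 _ (by positivity), neg_add, Real.exp_add]
    have e1 : -‖x - θ‖ ^ 2 / (2 * σX ^ 2) = -(1 / (2 * σX ^ 2) * ‖x - θ‖ ^ 2) := by ring
    have e2 : (1 - α ^ 2) / (4 * σY ^ 2 * (c ^ 2 * (1 - α) + 1 + α)) = 1 / (2 * γ₀) := by
      rw [hγ₀]; field_simp; ring
    rw [e1, e2]
    ring
  simp only [e]
  rw [integral_const_mul, integral_sub hp.1 (hg.1.const_mul _), hp.2, integral_const_mul, hg.2,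
    ← mul_assoc, ← Real.mul_rpow (by positivity) (by positivity)]
  have en : a • θ - θ = (a - 1) • θ := by rw [sub_smul, one_smul]
  rw [en, norm_smul, mul_pow, Real.norm_eq_abs, sq_abs]
  have hS : 1 / (2 * σX ^ 2) + 1 / (2 * γ₀) * a ^ 2 =
      (γ₀ + a ^ 2 * σX ^ 2) / (2 * σX ^ 2 * γ₀) := by field_simp
  have hT : 0 < γ₀ + a ^ 2 * σX ^ 2 := by positivity
  have hU : 2 * c ^ 2 * (1 - α) + 2 * (1 + α) + a ^ 2 * (1 - α ^ 2) * r =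
      (γ₀ + a ^ 2 * σX ^ 2) * (1 - α ^ 2) / σY ^ 2 := by
    rw [hγ₀, hr]; field_simp; ring
  have hK' : c ^ 2 * (1 - α) + 1 + α = γ₀ * (1 - α ^ 2) / (2 * σY ^ 2) := by
    rw [hγ₀]; field_simp
  rw [hS, hU, hK']
  congr 4
  · field_simp
    ring
  · field_simp
end

section
/- Fix α ∈ (-1,1) and r > 0, and for c > 0 define H(c) = 4c^{1-α}/(2c²(1-α) + 2(1+α) + (1-α²)r). Then H is strictly increasing on (0, c_opt) and strictly decreasing on (c_opt, ∞), where c_opt = √(1 + r(1-α)/2). Consequently, for every d ≥ 1 the function c ↦ (4/(1-α²))(1 − H(c)^{d/2}), which is the (constant in θ) α-divergence risk of the predictive density N_d(X, c²σ_Y² I_d), is uniquely minimized over c > 0 at c = c_opt. -/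
open MeasureTheory Real

theorem stmt3 (α r : ℝ) (hα : α ∈ Set.Ioo (-1 : ℝ) 1) (hr : 0 < r)
    (H : ℝ → ℝ)
    (hH : ∀ c : ℝ, H c =
      4 * c ^ (1 - α) / (2 * c ^ 2 * (1 - α) + 2 * (1 + α) + (1 - α ^ 2) * r))
    (copt : ℝ) (hcopt : copt = Real.sqrt (1 + r * (1 - α) / 2)) :
    StrictMonoOn H (Set.Ioo 0 copt) ∧
    StrictAntiOn H (Set.Ioi copt) ∧
    ∀ d : ℕ, 1 ≤ d → ∀ c : ℝ, 0 < c → c ≠ copt →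
      (4 / (1 - α ^ 2)) * (1 - H copt ^ ((d : ℝ) / 2)) <
        (4 / (1 - α ^ 2)) * (1 - H c ^ ((d : ℝ) / 2)) := by
  obtain ⟨h1, h2⟩ := hα
  have ha : 0 < 1 - α := by linarith
  have hb : 0 < 1 + α := by linarith
  have hab : 0 < 1 - α ^ 2 := by nlinarith
  have hrad : 0 < 1 + r * (1 - α) / 2 := by positivity
  have hc0 : 0 < copt := by rw [hcopt]; exact Real.sqrt_pos.mpr hrad
  have hcsq : copt ^ 2 = 1 + r * (1 - α) / 2 := by rw [hcopt]; exact Real.sq_sqrt hrad.le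
  have hD : ∀ c : ℝ, 0 < 2 * c ^ 2 * (1 - α) + 2 * (1 + α) + (1 - α ^ 2) * r := by
    intro c
    positivity
  have hHf : H = fun c : ℝ =>
      4 * c ^ (1 - α) / (2 * c ^ 2 * (1 - α) + 2 * (1 + α) + (1 - α ^ 2) * r) := funext hH
  have hder : ∀ c : ℝ, 0 < c → HasDerivAt H
      (8 * (1 - α) * (1 + α) * c ^ (-α) * (copt ^ 2 - c ^ 2) /
        (2 * c ^ 2 * (1 - α) + 2 * (1 + α) + (1 - α ^ 2) * r) ^ 2) c := by
    intro c hc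
    have e1 : HasDerivAt (fun c : ℝ => 4 * c ^ (1 - α)) (4 * ((1 - α) * c ^ (1 - α - 1))) c :=
      (Real.hasDerivAt_rpow_const (Or.inl hc.ne')).const_mul 4
    have e2 : HasDerivAt (fun c : ℝ => 2 * c ^ 2 * (1 - α) + 2 * (1 + α) + (1 - α ^ 2) * r)
        (4 * c * (1 - α)) c := by
      have := (((((hasDerivAt_id c).pow 2).const_mul 2).mul_const (1 - α)).add_const
        (2 * (1 + α))).add_const ((1 - α ^ 2) * r)
      refine this.congr_deriv ?_
      simp only [id, Nat.cast_ofNat, Nat.add_one_sub_one, pow_one]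
      norm_num only [pow_one]
      ring
    have e3 := e1.div e2 (hD c).ne'
    rw [hHf]
    refine e3.congr_deriv ?_
    congr 1
    have x1 : c ^ (1 - α) = c * c ^ (-α) := by
      rw [sub_eq_add_neg, Real.rpow_add hc, Real.rpow_one]
    have x2 : 1 - α - 1 = -α := by ring
    rw [x2, x1, hcsq]
    ring
  have hmono : StrictMonoOn H (Set.Ioc 0 copt) := by
    apply strictMonoOn_of_deriv_pos (convex_Ioc 0 copt)
    · intro c hc
      exact (hder c hc.1).continuousAt.continuousWithinAt
    · intro c hc
      rw [interior_Ioc] at hc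
      rw [(hder c hc.1).deriv]
      have := hD c
      have hp : 0 < c ^ (-α) := Real.rpow_pos_of_pos hc.1 _
      have hq : 0 < copt ^ 2 - c ^ 2 := by nlinarith [hc.1, hc.2]
      positivity
  have hanti : StrictAntiOn H (Set.Ici copt) := by
    apply strictAntiOn_of_deriv_neg (convex_Ici copt)
    · intro c hc
      exact (hder c (lt_of_lt_of_le hc0 hc)).continuousAt.continuousWithinAt
    · intro c hc
      rw [interior_Ici] at hc
      have hc' : copt < c := hc
      have hcp : 0 < c := hc0.trans hc'
      rw [(hder c hcp).deriv]
      have := hD c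
      have hp : 0 < c ^ (-α) := Real.rpow_pos_of_pos hcp _
      have hq : copt ^ 2 - c ^ 2 < 0 := by nlinarith
      apply div_neg_of_neg_of_pos _ (by positivity)
      exact mul_neg_of_pos_of_neg (by positivity) hq
  refine ⟨hmono.mono Set.Ioo_subset_Ioc_self, hanti.mono Set.Ioi_subset_Ici_self, ?_⟩
  intro d hd c hc hne
  have hlt : H c < H copt := by
    rcases lt_or_gt_of_ne hne with h | h
    · exact hmono ⟨hc, h.le⟩ ⟨hc0, le_rfl⟩ h
    · exact hanti (Set.mem_Ici.mpr le_rfl) (Set.mem_Ici.mpr h.le) h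
  have hHc : 0 ≤ H c := by
    rw [hH]
    have := hD c
    positivity
  have hd' : (0 : ℝ) < (d : ℝ) / 2 := by
    have : (1 : ℝ) ≤ d := by exact_mod_cast hd
    linarith
  have := Real.rpow_lt_rpow hHc hlt hd'
  apply mul_lt_mul_of_pos_left _ (by positivity)
  linarith
end

section
/- Let α ∈ (-1,1), 0 < a ≤ 1, r > 0, and define H(c) = 4c^{1-α}/(2c²(1-α) + 2(1+α) + a²(1-α²)r) for c > 0. Then H is strictly increasing in c on the interval where 1 ≤ c² ≤ 1 + a²r(1-α)/2; consequently every solution c ∈ (1,∞) of the cut-off equation 2(1-α)c² − (4 + (1-α²)a²r)c^{1-α} + (1+α)(2 + (1-α)a²r) = 0 satisfies c² ≥ 1 + a²r(1-α)/2. -/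
open Real

theorem stmt6 (α a r : ℝ) (hα : α ∈ Set.Ioo (-1 : ℝ) 1) (ha : 0 < a) (ha1 : a ≤ 1)
    (hr : 0 < r)
    (H : ℝ → ℝ)
    (hH : ∀ c : ℝ, H c =
      4 * c ^ (1 - α) / (2 * c ^ 2 * (1 - α) + 2 * (1 + α) + a ^ 2 * (1 - α ^ 2) * r)) :
    StrictMonoOn H {c : ℝ | 0 < c ∧ 1 ≤ c ^ 2 ∧ c ^ 2 ≤ 1 + a ^ 2 * r * (1 - α) / 2} ∧
    ∀ c : ℝ, 1 < c →
      2 * (1 - α) * c ^ 2 - (4 + (1 - α ^ 2) * a ^ 2 * r) * c ^ (1 - α)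
          + (1 + α) * (2 + (1 - α) * a ^ 2 * r) = 0 →
      1 + a ^ 2 * r * (1 - α) / 2 ≤ c ^ 2 := by
  obtain ⟨h1, h2⟩ := hα
  have p1 : 0 < 1 - α := by linarith
  have p2 : 0 < 1 + α := by linarith
  have p3 : 0 < a ^ 2 * (1 - α ^ 2) * r := by
    have : 1 - α ^ 2 = (1 - α) * (1 + α) := by ring
    rw [this]; positivity
  have hD : ∀ c : ℝ, 0 < 2 * c ^ 2 * (1 - α) + 2 * (1 + α) + a ^ 2 * (1 - α ^ 2) * r := by
    intro c
    have : 0 ≤ 2 * c ^ 2 * (1 - α) := by positivity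
    linarith
  have hM : 0 < a ^ 2 * r * (1 - α) / 2 := by positivity
  have hder : ∀ c : ℝ, 0 < c → HasDerivAt H
      (((4 * ((1 - α) * c ^ (1 - α - 1))) *
        (2 * c ^ 2 * (1 - α) + 2 * (1 + α) + a ^ 2 * (1 - α ^ 2) * r)
        - 4 * c ^ (1 - α) * (4 * c * (1 - α))) /
        (2 * c ^ 2 * (1 - α) + 2 * (1 + α) + a ^ 2 * (1 - α ^ 2) * r) ^ 2) c := by
    intro c hc
    rw [funext hH]
    have e1 : HasDerivAt (fun c : ℝ => 4 * c ^ (1 - α)) (4 * ((1 - α) * c ^ (1 - α - 1))) c :=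
      (Real.hasDerivAt_rpow_const (Or.inl hc.ne')).const_mul 4
    have e2 : HasDerivAt (fun c : ℝ => 2 * c ^ 2 * (1 - α) + 2 * (1 + α) + a ^ 2 * (1 - α ^ 2) * r)
        (4 * c * (1 - α)) c := by
      have := ((((hasDerivAt_pow 2 c).const_mul 2).mul_const (1 - α)).add_const
        (2 * (1 + α))).add_const (a ^ 2 * (1 - α ^ 2) * r)
      refine this.congr_deriv ?_
      push_cast
      ring
    exact e1.div e2 (hD c).ne'
  have hset : {c : ℝ | 0 < c ∧ 1 ≤ c ^ 2 ∧ c ^ 2 ≤ 1 + a ^ 2 * r * (1 - α) / 2}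
      = Set.Icc 1 (√(1 + a ^ 2 * r * (1 - α) / 2)) := by
    ext c
    simp only [Set.mem_ofPred_eq, Set.mem_Icc]
    constructor
    · rintro ⟨q1, q2, q3⟩
      exact ⟨by nlinarith, Real.le_sqrt_of_sq_le q3⟩
    · rintro ⟨q1, q2⟩
      exact ⟨by linarith, by nlinarith, (Real.le_sqrt (by linarith) (by linarith)).1 q2⟩
  have hmono : StrictMonoOn H
      {c : ℝ | 0 < c ∧ 1 ≤ c ^ 2 ∧ c ^ 2 ≤ 1 + a ^ 2 * r * (1 - α) / 2} := by
    rw [hset]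
    apply strictMonoOn_of_deriv_pos (convex_Icc _ _)
    · intro c hc
      exact (hder c (by linarith [hc.1])).continuousAt.continuousWithinAt
    · intro c hc
      rw [interior_Icc] at hc
      have hc0 : 0 < c := by linarith [hc.1]
      rw [(hder c hc0).deriv]
      apply div_pos _ (pow_pos (hD c) 2)
      have hlt : c ^ 2 < 1 + a ^ 2 * r * (1 - α) / 2 := (Real.lt_sqrt hc0.le).1 hc.2
      have e : c ^ (1 - α) = c ^ (1 - α - 1) * c := by
        rw [← Real.rpow_add_one hc0.ne']; congr 1; ring
      rw [e]
      have hp : 0 < c ^ (1 - α - 1) := Real.rpow_pos_of_pos hc0 _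
      have : 0 < c ^ (1 - α - 1) * ((1 - α) * ((1 + α) *
          (8 * (1 + a ^ 2 * r * (1 - α) / 2 - c ^ 2)))) := by
        have : 0 < 1 + a ^ 2 * r * (1 - α) / 2 - c ^ 2 := by linarith
        positivity
      linarith only [this]
  refine ⟨hmono, fun c hc heq => ?_⟩
  by_contra hlt
  push Not at hlt
  have hh := hmono (a := 1) ⟨one_pos, by norm_num, by linarith⟩
    (b := c) ⟨by linarith, by nlinarith, hlt.le⟩ hc
  rw [hH, hH, div_lt_div_iff₀ (hD _) (hD _), Real.one_rpow] at hh
  nlinarith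
end

section
/- Let α ∈ (-1,1) and 0 < a ≤ 1, and for r > 0 let k(r) denote the unique solution in c ∈ (1,∞) of 2(1-α)c² − (4 + (1-α²)a²r)c^{1-α} + (1+α)(2 + (1-α)a²r) = 0. Then k is strictly increasing on (0,∞) and k(r) → 1 as r → 0⁺. -/
open Real Filter

lemma aux_pow (b c : ℝ) (hb : 0 < b) (hc : 1 < c) : (c ^ b) ^ (2 / b) = c ^ 2 := by
  rw [← Real.rpow_mul (by linarith), mul_div_cancel₀ _ hb.ne']
  exact Real.rpow_two c

lemma aux_mono (b : ℝ) (hb : 0 < b) (hb2 : b < 2) :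
    StrictMonoOn (fun c : ℝ => (c ^ 2 - 1) / (c ^ b - 1)) (Set.Ioi 1) := by
  intro x hx y hy hxy
  have hx' : (1 : ℝ) < x := hx
  have hy' : (1 : ℝ) < y := hy
  have hp : 1 < 2 / b := by rw [lt_div_iff₀ hb]; linarith
  have hux : 1 < x ^ b := Real.one_lt_rpow hx' hb
  have huy : 1 < y ^ b := Real.one_lt_rpow hy' hb
  have huv : x ^ b < y ^ b := Real.rpow_lt_rpow (by linarith) hxy hb
  have h := (strictConvexOn_rpow hp).secant_strict_mono (a := 1) (x := x ^ b) (y := y ^ b)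
    (Set.mem_Ici.2 zero_le_one) (Set.mem_Ici.2 (by linarith)) (Set.mem_Ici.2 (by linarith))
    hux.ne' huy.ne' huv
  simp only [aux_pow b x hb hx', aux_pow b y hb hy', Real.one_rpow] at h
  exact h

lemma aux_lb (b c : ℝ) (hb : 0 < b) (hb2 : b < 2) (hc : 1 < c) :
    4 < 2 * b * ((c ^ 2 - 1) / (c ^ b - 1)) := by
  have hp : 1 < 2 / b := by rw [lt_div_iff₀ hb]; linarith
  have hu : 1 < c ^ b := Real.one_lt_rpow hc hb
  have h := one_add_mul_self_lt_rpow_one_add (s := c ^ b - 1) (by linarith) (by linarith) hp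
  rw [add_sub_cancel, aux_pow b c hb hc] at h
  have h2 : 2 / b < (c ^ 2 - 1) / (c ^ b - 1) := by
    rw [lt_div_iff₀ (by linarith)]; linarith
  rw [div_lt_iff₀ hb] at h2
  linarith

theorem stmt7 (α a : ℝ) (hα : α ∈ Set.Ioo (-1 : ℝ) 1) (ha : 0 < a) (ha1 : a ≤ 1)
    (k : ℝ → ℝ)
    (hk : ∀ r : ℝ, 0 < r → 1 < k r ∧
      2 * (1 - α) * (k r) ^ 2 - (4 + (1 - α ^ 2) * a ^ 2 * r) * (k r) ^ (1 - α)
          + (1 + α) * (2 + (1 - α) * a ^ 2 * r) = 0) :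
    StrictMonoOn k (Set.Ioi 0) ∧
      Tendsto k (nhdsWithin 0 (Set.Ioi 0)) (nhds 1) := by
  obtain ⟨h1, h2⟩ := hα
  have hb : 0 < 1 - α := by linarith
  have hb2 : 1 - α < 2 := by linarith
  have hM : 0 < (1 - α ^ 2) * a ^ 2 := by
    have : 0 < 1 - α ^ 2 := by nlinarith
    positivity
  have hmono := aux_mono (1 - α) hb hb2
  have key : ∀ r : ℝ, 0 < r → 4 + (1 - α ^ 2) * a ^ 2 * r =
      2 * (1 - α) * (((k r) ^ 2 - 1) / ((k r) ^ (1 - α) - 1)) := by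
    intro r hr
    obtain ⟨hk1, he⟩ := hk r hr
    have hu : 1 < (k r) ^ (1 - α) := Real.one_lt_rpow hk1 hb
    rw [← mul_div_assoc, eq_div_iff (by linarith)]
    linarith
  have main : ∀ r : ℝ, 0 < r → ∀ c : ℝ, 1 < c → 4 + (1 - α ^ 2) * a ^ 2 * r <
      2 * (1 - α) * ((c ^ 2 - 1) / (c ^ (1 - α) - 1)) → k r < c := by
    intro r hr c hc h
    rw [key r hr] at h
    exact (hmono.lt_iff_lt (Set.mem_Ioi.2 (hk r hr).1) (Set.mem_Ioi.2 hc)).1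
      (lt_of_mul_lt_mul_left h (by linarith))
  refine ⟨?_, ?_⟩
  · intro x hx y hy hxy
    refine main x hx (k y) (hk y hy).1 ?_
    rw [← key y hy]
    have := mul_lt_mul_of_pos_left hxy hM
    linarith
  · rw [tendsto_order]
    constructor
    · intro c hc
      filter_upwards [self_mem_nhdsWithin] with r hr
      exact hc.trans (hk r hr).1
    · intro c hc
      have hl := aux_lb (1 - α) c hb hb2 hc
      have hd : 0 < (2 * (1 - α) * ((c ^ 2 - 1) / (c ^ (1 - α) - 1)) - 4)
          / ((1 - α ^ 2) * a ^ 2) := div_pos (by linarith) hM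
      filter_upwards [Ioo_mem_nhdsGT hd] with r hr
      refine main r hr.1 c hc ?_
      have := (lt_div_iff₀ hM).1 hr.2
      linarith
end

section
/- Let X ~ N(θ, σ_X²) with σ_X > 0, θ ∈ ℝ, and let γ₀ > 0. Then E[exp(−(max{X,0} − θ)²/(2γ₀))] = exp(−θ²/(2γ₀)) Φ(−θ/σ_X) + γ₁ Φ(θ/(γ₁ σ_X)), where γ₁ = √(γ₀/(γ₀ + σ_X²)) and Φ is the standard normal cumulative distribution function. -/
open MeasureTheory Real

/-- Density of the univariate `N(μ, v)` distribution (with `v` the variance). -/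
noncomputable def gaussPdf1 (μ v x : ℝ) : ℝ :=
  (2 * π * v) ^ (-(1 : ℝ) / 2) * Real.exp (-(x - μ) ^ 2 / (2 * v))

/-- The standard normal cumulative distribution function `Φ`. -/
noncomputable def stdNormalCdf (z : ℝ) : ℝ :=
  ∫ t in Set.Iic z, gaussPdf1 0 1 t

lemma gp_const (s : ℝ) (hs : 0 < s) :
    (2 * π * s ^ 2) ^ (-(1 : ℝ) / 2) = (2 * π) ^ (-(1 : ℝ) / 2) * s⁻¹ := by
  rw [Real.mul_rpow (by positivity) (by positivity), ← Real.rpow_natCast s 2,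
    ← Real.rpow_mul hs.le]
  norm_num [Real.rpow_neg_one]

lemma gp_scale (θ s x : ℝ) (hs : 0 < s) :
    gaussPdf1 0 1 ((x - θ) / s) = s * gaussPdf1 θ (s ^ 2) x := by
  unfold gaussPdf1
  rw [gp_const s hs]
  have : -((x - θ) / s - 0) ^ 2 / (2 * 1) = -(x - θ) ^ 2 / (2 * s ^ 2) := by
    field_simp
    ring
  rw [this, mul_one]
  field_simp

lemma gp_integrable (θ s : ℝ) (hs : 0 < s) : Integrable (gaussPdf1 θ (s ^ 2)) := by
  have h := (integrable_exp_neg_mul_sq (b := 1 / (2 * s ^ 2)) (by positivity)).comp_sub_right θ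
  have h2 := h.const_mul ((2 * π * s ^ 2) ^ (-(1 : ℝ) / 2))
  refine h2.congr (Filter.Eventually.of_forall fun x => ?_)
  simp only [gaussPdf1]
  congr 2
  ring

lemma gp_Iic (θ s : ℝ) (hs : 0 < s) :
    ∫ x in Set.Iic 0, gaussPdf1 θ (s ^ 2) x = stdNormalCdf (-θ / s) := by
  unfold stdNormalCdf
  rw [← integral_indicator measurableSet_Iic, ← integral_indicator measurableSet_Iic]
  set F := (Set.Iic (-θ / s)).indicator (gaussPdf1 0 1) with hF
  have h1 : ∫ x, F ((x - θ) / s) = |s| • ∫ y, F y := by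
    rw [integral_sub_right_eq_self (fun x => F (x / s)) θ, Measure.integral_comp_div]
  have h2 : ∀ x, F ((x - θ) / s) =
      s * (Set.Iic (0 : ℝ)).indicator (gaussPdf1 θ (s ^ 2)) x := by
    intro x
    have hiff : (x - θ) / s ≤ -θ / s ↔ x ≤ 0 := by
      rw [div_le_div_iff_of_pos_right hs]
      constructor <;> intro h <;> linarith
    by_cases hx : x ≤ 0
    · rw [hF, Set.indicator_of_mem (by exact hiff.2 hx), Set.indicator_of_mem (by exact hx),
        gp_scale θ s x hs]
    · rw [hF, Set.indicator_of_notMem (by exact fun h => hx (hiff.1 h)),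
        Set.indicator_of_notMem (by exact hx), mul_zero]
  simp_rw [h2] at h1
  rw [integral_const_mul, abs_of_pos hs, smul_eq_mul] at h1
  exact mul_left_cancel₀ hs.ne' h1

lemma gp_Ioi (θ s : ℝ) (hs : 0 < s) :
    ∫ x in Set.Ioi 0, gaussPdf1 θ (s ^ 2) x = stdNormalCdf (θ / s) := by
  have h := gp_Iic (-θ) s hs
  rw [neg_neg] at h
  rw [← h]
  have h3 := integral_comp_neg_Ioi (0 : ℝ) (gaussPdf1 (-θ) (s ^ 2))
  rw [neg_zero] at h3
  rw [← h3]
  congr 1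
  ext x
  unfold gaussPdf1
  congr 3
  ring

theorem stmt8 (θ σX γ₀ : ℝ) (hσX : 0 < σX) (hγ₀ : 0 < γ₀)
    (γ₁ : ℝ) (hγ₁ : γ₁ = Real.sqrt (γ₀ / (γ₀ + σX ^ 2))) :
    (∫ x, gaussPdf1 θ (σX ^ 2) x * Real.exp (-(max x 0 - θ) ^ 2 / (2 * γ₀))) =
      Real.exp (-θ ^ 2 / (2 * γ₀)) * stdNormalCdf (-θ / σX) +
        γ₁ * stdNormalCdf (θ / (γ₁ * σX)) := by
  have hg1 : 0 < γ₁ := by rw [hγ₁]; positivity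
  have hsq : γ₁ ^ 2 = γ₀ / (γ₀ + σX ^ 2) := by rw [hγ₁, Real.sq_sqrt (by positivity)]
  have hs' : 0 < γ₁ * σX := by positivity
  have eL : Set.EqOn (fun x => gaussPdf1 θ (σX ^ 2) x * Real.exp (-(max x 0 - θ) ^ 2 / (2 * γ₀)))
      (fun x => Real.exp (-θ ^ 2 / (2 * γ₀)) * gaussPdf1 θ (σX ^ 2) x) (Set.Iic 0) := by
    intro x hx
    have hx' : max x 0 = 0 := max_eq_right hx
    simp only [hx', zero_sub, neg_sq]
    ring
  have eR : Set.EqOn (fun x => gaussPdf1 θ (σX ^ 2) x * Real.exp (-(max x 0 - θ) ^ 2 / (2 * γ₀)))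
      (fun x => γ₁ * gaussPdf1 θ ((γ₁ * σX) ^ 2) x) (Set.Ioi 0) := by
    intro x hx
    have hx' : max x 0 = x := max_eq_left (le_of_lt hx)
    simp only [hx', gaussPdf1]
    rw [gp_const _ hs', gp_const _ hσX, mul_assoc _ (Real.exp _) (Real.exp _), ← Real.exp_add]
    have : -(x - θ) ^ 2 / (2 * σX ^ 2) + -(x - θ) ^ 2 / (2 * γ₀)
        = -(x - θ) ^ 2 / (2 * (γ₁ * σX) ^ 2) := by
      rw [mul_pow, hsq]
      field_simp
      ring
    rw [this]
    field_simp
  have iL := ((gp_integrable θ σX hσX).const_mul (Real.exp (-θ ^ 2 / (2 * γ₀)))).integrableOn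
    (s := Set.Iic 0)
  have iR := ((gp_integrable θ _ hs').const_mul γ₁).integrableOn (s := Set.Ioi 0)
  rw [← intervalIntegral.integral_Iic_add_Ioi (iL.congr_fun eL.symm measurableSet_Iic)
      (iR.congr_fun eR.symm measurableSet_Ioi),
    setIntegral_congr_fun measurableSet_Iic eL, setIntegral_congr_fun measurableSet_Ioi eR,
    integral_const_mul, integral_const_mul, gp_Iic θ σX hσX, gp_Ioi θ _ hs']
end

section
/- Let d = 1, α ∈ (-1,1), σ_X, σ_Y > 0, r = σ_X²/σ_Y², θ̂₊(X) = max{X, 0}, and let κ(α, r) ∈ (1,∞) be the unique solution of A₂(c) = (1 + r(1-α²)/4)^{-1/2}, where A₂ is as in the dominance theorem for θ̂₊. Then for every c with 1 < c ≤ κ(α, r), the risk inequality R_α(θ, q_{θ̂₊,c}) ≤ R_α(θ, q_{θ̂₊,1}) holds for every θ ∈ ℝ, including all negative values θ < 0. -/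
open MeasureTheory Real

/-- The α-divergence loss of a predictive density `p` for a target density `q` on `ℝ`. -/
noncomputable def alphaLoss1 (α : ℝ) (q p : ℝ → ℝ) : ℝ :=
  ∫ y, (4 / (1 - α ^ 2)) * (1 - (p y / q y) ^ ((1 + α) / 2)) * q y

/-- Frequentist α-divergence risk of the predictive density `N(θhat X, c²σ_Y²)`
for the target `N(θ, σ_Y²)`, with `X ~ N(θ, σ_X²)`. -/
noncomputable def alphaRisk1 (α σX σY : ℝ) (θhat : ℝ → ℝ) (c θ : ℝ) : ℝ :=
  ∫ x, gaussPdf1 θ (σX ^ 2) x *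
    alphaLoss1 α (gaussPdf1 θ (σY ^ 2)) (gaussPdf1 (θhat x) (c ^ 2 * σY ^ 2))

lemma gaussPdf1_eq_exp (μ v x : ℝ) (hv : 0 < v) :
    gaussPdf1 μ v x = Real.exp (-(1/2) * Real.log (2 * π * v) - (x - μ) ^ 2 / (2 * v)) := by
  have h : 0 < 2 * π * v := by positivity
  unfold gaussPdf1
  rw [Real.rpow_def_of_pos h, ← Real.exp_add]
  congr 1
  ring

lemma gaussPdf1_eq (μ v : ℝ) (hv : 0 < v) :
    gaussPdf1 μ v = ProbabilityTheory.gaussianPDFReal μ ⟨v, hv.le⟩ := by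
  have h : 0 < 2 * π * v := by positivity
  funext x
  unfold gaussPdf1 ProbabilityTheory.gaussianPDFReal
  rw [neg_div, Real.rpow_neg h.le, ← Real.sqrt_eq_rpow]
  rfl

lemma gaussPdf1_integrable (μ v : ℝ) (hv : 0 < v) : Integrable (gaussPdf1 μ v) := by
  rw [gaussPdf1_eq μ v hv]
  exact ProbabilityTheory.integrable_gaussianPDFReal _ _

lemma gaussPdf1_integral (μ v : ℝ) (hv : 0 < v) : ∫ x, gaussPdf1 μ v x = 1 := by
  rw [gaussPdf1_eq μ v hv]
  apply ProbabilityTheory.integral_gaussianPDFReal_eq_one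
  intro h
  exact hv.ne' (congrArg NNReal.toReal h)

lemma gaussPdf1_nonneg (μ v x : ℝ) (hv : 0 < v) : 0 ≤ gaussPdf1 μ v x := by
  rw [gaussPdf1_eq_exp μ v x hv]; positivity

lemma my_sqrt_exp (x : ℝ) (hx : 0 < x) : Real.sqrt x = Real.exp (1/2 * Real.log x) := by
  rw [Real.sqrt_eq_rpow, Real.rpow_def_of_pos hx]
  congr 1; ring

lemma D_pos (α c : ℝ) (hα : α ∈ Set.Ioo (-1 : ℝ) 1) : 0 < c ^ 2 * (1 - α) + 1 + α := by
  have h1 : 0 < 1 - α := by linarith [hα.2]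
  have h2 : 0 < 1 + α := by linarith [hα.1]
  nlinarith [mul_nonneg (sq_nonneg c) h1.le]

lemma den_pos (α : ℝ) (hα : α ∈ Set.Ioo (-1 : ℝ) 1) : 0 < 1 - α ^ 2 := by
  nlinarith [hα.1, hα.2]

lemma loss_pointwise (α σ c m θ y : ℝ) (hα : α ∈ Set.Ioo (-1 : ℝ) 1) (hσ : 0 < σ) (hc : 0 < c) :
    (gaussPdf1 m (c ^ 2 * σ ^ 2) y / gaussPdf1 θ (σ ^ 2) y) ^ ((1 + α) / 2) * gaussPdf1 θ (σ ^ 2) y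
     = Real.sqrt (2 * c ^ (1 - α) / (c ^ 2 * (1 - α) + 1 + α)) *
        Real.exp (-(m - θ) ^ 2 / (2 * (2 * σ ^ 2 * (c ^ 2 * (1 - α) + 1 + α) / (1 - α ^ 2)))) *
        gaussPdf1 (((1 + α) * m + c ^ 2 * (1 - α) * θ) / (c ^ 2 * (1 - α) + 1 + α))
          (2 * c ^ 2 * σ ^ 2 / (c ^ 2 * (1 - α) + 1 + α)) y := by
  have hD := D_pos α c hα
  have h1 : 1 - α ≠ 0 := by linarith [hα.2]
  have h2 : 1 + α ≠ 0 := by linarith [hα.1]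
  have h12 : 1 - α ^ 2 = (1 - α) * (1 + α) := by ring
  have hcp : 0 < c ^ (1 - α) := Real.rpow_pos_of_pos hc _
  rw [h12]
  set D := c ^ 2 * (1 - α) + 1 + α with hDdef
  rw [gaussPdf1_eq_exp m _ y (by positivity), gaussPdf1_eq_exp θ _ y (by positivity),
    gaussPdf1_eq_exp _ _ y (by positivity), my_sqrt_exp _ (by positivity), ← Real.exp_sub,
    ← Real.exp_mul, ← Real.exp_add, ← Real.exp_add, ← Real.exp_add]
  congr 1
  have l1 : Real.log (2 * π * (c ^ 2 * σ ^ 2)) =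
      Real.log 2 + Real.log π + 2 * Real.log c + 2 * Real.log σ := by
    rw [Real.log_mul (by positivity) (by positivity), Real.log_mul (by positivity) (by positivity),
      Real.log_mul (by positivity) (by positivity), Real.log_pow, Real.log_pow]
    push_cast; ring
  have l2 : Real.log (2 * π * σ ^ 2) = Real.log 2 + Real.log π + 2 * Real.log σ := by
    rw [Real.log_mul (by positivity) (by positivity), Real.log_mul (by positivity) (by positivity),
      Real.log_pow]
    push_cast; ring
  have l3 : Real.log (2 * π * (2 * c ^ 2 * σ ^ 2 / D)) =
      2 * Real.log 2 + Real.log π + 2 * Real.log c + 2 * Real.log σ - Real.log D := by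
    rw [Real.log_mul (by positivity) (by positivity), Real.log_mul (by positivity) (by positivity),
      Real.log_div (by positivity) (by positivity),
      Real.log_mul (by positivity) (by positivity), Real.log_mul (by positivity) (by positivity),
      Real.log_pow, Real.log_pow]
    push_cast; ring
  have l4 : Real.log (2 * c ^ (1 - α) / D) = Real.log 2 + (1 - α) * Real.log c - Real.log D := by
    rw [Real.log_div (by positivity) (by positivity),
      Real.log_mul (by positivity) (by positivity), Real.log_rpow hc]
  rw [l1, l2, l3, l4]
  have key : ((y - m) ^ 2 / (2 * (c ^ 2 * σ ^ 2)) - (y - θ) ^ 2 / (2 * σ ^ 2)) * ((1 + α) / 2)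
      + (y - θ) ^ 2 / (2 * σ ^ 2) =
      (m - θ) ^ 2 / (2 * (2 * σ ^ 2 * D / ((1 - α) * (1 + α)))) +
      (y - ((1 + α) * m + c ^ 2 * (1 - α) * θ) / D) ^ 2 / (2 * (2 * c ^ 2 * σ ^ 2 / D)) := by
    have hD' : D ≠ 0 := hD.ne'
    field_simp
    rw [hDdef]
    ring
  rw [neg_div]
  linear_combination -key

lemma loss_eq (α σ c m θ : ℝ) (hα : α ∈ Set.Ioo (-1 : ℝ) 1) (hσ : 0 < σ) (hc : 0 < c) :
    alphaLoss1 α (gaussPdf1 θ (σ ^ 2)) (gaussPdf1 m (c ^ 2 * σ ^ 2)) =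
      4 / (1 - α ^ 2) * (1 - Real.sqrt (2 * c ^ (1 - α) / (c ^ 2 * (1 - α) + 1 + α)) *
        Real.exp (-(m - θ) ^ 2 / (2 * (2 * σ ^ 2 * (c ^ 2 * (1 - α) + 1 + α) / (1 - α ^ 2))))) := by
  have hD := D_pos α c hα
  unfold alphaLoss1
  have hv : 0 < 2 * c ^ 2 * σ ^ 2 / (c ^ 2 * (1 - α) + 1 + α) := by positivity
  have hs : 0 < σ ^ 2 := by positivity
  simp_rw [mul_assoc (4 / (1 - α ^ 2)), sub_mul, one_mul, loss_pointwise α σ c m θ _ hα hσ hc]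
  rw [integral_const_mul, integral_sub (gaussPdf1_integrable _ _ hs)
    ((gaussPdf1_integrable _ _ hv).const_mul _), integral_const_mul, gaussPdf1_integral _ _ hs,
    gaussPdf1_integral _ _ hv, mul_one]

lemma gauss_exp (s γ : ℝ) (hs : 0 < s) (hγ : 0 < γ) :
    ∫ z, gaussPdf1 0 s z * Real.exp (-z ^ 2 / (2 * γ)) = Real.sqrt (γ / (γ + s)) := by
  have hv : 0 < s * (γ / (γ + s)) := by positivity
  have : ∀ z, gaussPdf1 0 s z * Real.exp (-z ^ 2 / (2 * γ)) =
      Real.sqrt (γ / (γ + s)) * gaussPdf1 0 (s * (γ / (γ + s))) z := by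
    intro z
    rw [gaussPdf1_eq_exp _ _ _ hs, gaussPdf1_eq_exp _ _ _ hv, my_sqrt_exp _ (by positivity),
      ← Real.exp_add, ← Real.exp_add, ← mul_assoc (2 * π) s, Real.log_mul (x := 2 * π * s)
      (by positivity) (by positivity)]
    congr 1
    have : z ^ 2 / (2 * s) + z ^ 2 / (2 * γ) = z ^ 2 / (2 * (s * (γ / (γ + s)))) := by
      field_simp
    rw [sub_zero, neg_div]
    linear_combination -this
  simp_rw [this]
  rw [integral_const_mul, gaussPdf1_integral _ _ hv, mul_one]

lemma exp_int (s γ θ : ℝ) (hs : 0 < s) (hγ : 0 < γ) (h : ℝ → ℝ) (hh : Continuous h) :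
    Integrable (fun x => gaussPdf1 θ s x * Real.exp (-(h x) ^ 2 / (2 * γ))) := by
  refine (gaussPdf1_integrable θ s hs).mul_bdd (c := 1) ?_ ?_
  · exact Continuous.aestronglyMeasurable (by fun_prop)
  · refine Filter.Eventually.of_forall fun x => ?_
    rw [Real.norm_eq_abs, abs_of_pos (Real.exp_pos _), Real.exp_le_one_iff]
    have : 0 ≤ (h x) ^ 2 / (2 * γ) := by positivity
    rw [neg_div]; linarith

lemma risk_eq (α σX σY c θ : ℝ) (hα : α ∈ Set.Ioo (-1 : ℝ) 1) (hσX : 0 < σX) (hσY : 0 < σY)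
    (hc : 0 < c) :
    alphaRisk1 α σX σY (fun x => max x 0) c θ = 4 / (1 - α ^ 2) *
      (1 - Real.sqrt (2 * c ^ (1 - α) / (c ^ 2 * (1 - α) + 1 + α)) *
        ∫ z, gaussPdf1 0 (σX ^ 2) z * Real.exp (-(max z (-θ)) ^ 2 /
          (2 * (2 * σY ^ 2 * (c ^ 2 * (1 - α) + 1 + α) / (1 - α ^ 2))))) := by
  have hD := D_pos α c hα
  have h1 := den_pos α hα
  unfold alphaRisk1
  simp_rw [loss_eq α σY c _ θ hα hσY hc]
  have hγ : 0 < 2 * σY ^ 2 * (c ^ 2 * (1 - α) + 1 + α) / (1 - α ^ 2) := by positivity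
  generalize 2 * σY ^ 2 * (c ^ 2 * (1 - α) + 1 + α) / (1 - α ^ 2) = γ at *
  generalize Real.sqrt (2 * c ^ (1 - α) / (c ^ 2 * (1 - α) + 1 + α)) = A
  have hs : 0 < σX ^ 2 := by positivity
  have e : ∀ x, gaussPdf1 θ (σX ^ 2) x * (4 / (1 - α ^ 2) *
      (1 - A * Real.exp (-(max x 0 - θ) ^ 2 / (2 * γ)))) = 4 / (1 - α ^ 2) *
      (gaussPdf1 θ (σX ^ 2) x - A * (gaussPdf1 θ (σX ^ 2) x *
        Real.exp (-(max x 0 - θ) ^ 2 / (2 * γ)))) := by intro x; ring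
  simp_rw [e]
  rw [integral_const_mul, integral_sub (gaussPdf1_integrable _ _ hs)
    ((exp_int _ γ θ hs hγ (fun x => max x 0 - θ) (by fun_prop)).const_mul _), integral_const_mul,
    gaussPdf1_integral _ _ hs]
  congr 3
  rw [← integral_add_right_eq_self _ θ]
  congr 1
  funext z
  have : max (z + θ) 0 - θ = max z (-θ) := by
    rw [← max_sub_sub_right]; simp
  rw [this]
  unfold gaussPdf1
  simp

lemma A1_le_one (α c : ℝ) (hα : α ∈ Set.Ioo (-1 : ℝ) 1) (hc : 0 < c) :
    Real.sqrt (2 * c ^ (1 - α) / (c ^ 2 * (1 - α) + 1 + α)) ≤ 1 := by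
  have hD := D_pos α c hα
  refine Real.sqrt_le_iff.2 ⟨zero_le_one, ?_⟩
  rw [one_pow, div_le_one hD]
  have := Real.geom_mean_le_arith_mean2_weighted (w₁ := (1 - α) / 2) (w₂ := (1 + α) / 2)
    (p₁ := c ^ 2) (p₂ := 1) (by linarith [hα.2]) (by linarith [hα.1]) (by positivity) (by norm_num)
    (by ring)
  rw [Real.one_rpow, mul_one, ← Real.rpow_natCast, ← Real.rpow_mul hc.le, Real.rpow_natCast] at this
  have e : ((2 : ℕ) : ℝ) * ((1 - α) / 2) = 1 - α := by push_cast; ring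
  rw [e] at this
  linarith

/-- Core comparison. -/
lemma core (s γ γ' A t : ℝ) (hs : 0 < s) (hγ : 0 < γ) (hγ' : γ ≤ γ') (hA0 : 0 ≤ A) (hA1 : A ≤ 1)
    (h0 : 0 ≤ -1 + A * (1 + Real.sqrt (γ' / (γ' + s))) - Real.sqrt (γ / (γ + s))) :
    ∫ z, gaussPdf1 0 s z * Real.exp (-(max z t) ^ 2 / (2 * γ)) ≤
      A * ∫ z, gaussPdf1 0 s z * Real.exp (-(max z t) ^ 2 / (2 * γ')) := by
  have hγp : 0 < γ' := lt_of_lt_of_le hγ hγ'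
  set g : ℝ → ℝ := fun x => A * Real.exp (-x ^ 2 / (2 * γ')) - Real.exp (-x ^ 2 / (2 * γ)) with hg
  have hint : ∀ h : ℝ → ℝ, Continuous h → Integrable (fun z => gaussPdf1 0 s z * g (h z)) := by
    intro h hh
    have := ((exp_int s γ' 0 hs hγp h hh).const_mul A).sub (exp_int s γ 0 hs hγ h hh)
    refine this.congr (Filter.Eventually.of_forall fun z => ?_)
    simp only [hg, Pi.sub_apply]; ring
  have hval : ∀ h : ℝ → ℝ, Continuous h → ∫ z, gaussPdf1 0 s z * g (h z) =
      A * (∫ z, gaussPdf1 0 s z * Real.exp (-(h z) ^ 2 / (2 * γ')))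
        - ∫ z, gaussPdf1 0 s z * Real.exp (-(h z) ^ 2 / (2 * γ)) := by
    intro h hh
    rw [← integral_const_mul, ← integral_sub ((exp_int s γ' 0 hs hγp h hh).const_mul A)
      (exp_int s γ 0 hs hγ h hh)]
    congr 1; funext z
    simp only [hg]; ring
  have geven : ∀ x, g (-x) = g x := by intro x; simp [hg]
  have hpe : ∀ z, gaussPdf1 0 s (-z) = gaussPdf1 0 s z := by intro z; simp [gaussPdf1]
  have hexple : ∀ x : ℝ, Real.exp (-x ^ 2 / (2 * γ)) ≤ Real.exp (-x ^ 2 / (2 * γ')) := by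
    intro x
    rw [Real.exp_le_exp, neg_div, neg_div, neg_le_neg_iff]
    gcongr
  have gmin : ∀ x, g 0 ≤ g x := by
    intro x
    have h1 := hexple x
    have h2 : Real.exp (-x ^ 2 / (2 * γ')) ≤ 1 := by
      rw [Real.exp_le_one_iff, neg_div]
      have : 0 ≤ x ^ 2 / (2 * γ') := by positivity
      linarith
    simp only [hg]
    simp
    nlinarith
  have gmono : ∀ w x, 0 ≤ w → w ≤ x → g x ≤ 0 → g w ≤ g x := by
    intro w x hw hwx hx
    set δ := 1 / (2 * γ) - 1 / (2 * γ') with hδ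
    have hδ0 : 0 ≤ δ := by
      rw [hδ, sub_nonneg]; gcongr
    have gform : ∀ u, g u = Real.exp (-u ^ 2 / (2 * γ)) * (A * Real.exp (δ * u ^ 2) - 1) := by
      intro u
      have : Real.exp (-u ^ 2 / (2 * γ')) = Real.exp (-u ^ 2 / (2 * γ)) * Real.exp (δ * u ^ 2) := by
        rw [← Real.exp_add, hδ]; congr 1; ring
      simp only [hg]; rw [this]; ring
    have hsq : w ^ 2 ≤ x ^ 2 := by gcongr
    have e1 : Real.exp (δ * w ^ 2) ≤ Real.exp (δ * x ^ 2) := by gcongr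
    have e2 : Real.exp (-x ^ 2 / (2 * γ)) ≤ Real.exp (-w ^ 2 / (2 * γ)) := by gcongr
    have p1 : 0 < Real.exp (-x ^ 2 / (2 * γ)) := Real.exp_pos _
    have p2 : 0 < Real.exp (-w ^ 2 / (2 * γ)) := Real.exp_pos _
    rw [gform] at hx
    rw [gform, gform]
    have hx' : A * Real.exp (δ * x ^ 2) - 1 ≤ 0 := by
      by_contra hcon
      push Not at hcon
      nlinarith [mul_pos p1 hcon]
    have e3 : A * Real.exp (δ * w ^ 2) ≤ A * Real.exp (δ * x ^ 2) := by gcongr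
    nlinarith
  -- value at zero
  have G0 : 0 ≤ ∫ z, gaussPdf1 0 s z * g (max z 0) := by
    have r1 : ∫ z, gaussPdf1 0 s z * g (max (-z) 0) = ∫ z, gaussPdf1 0 s z * g (max z 0) := by
      rw [← integral_neg_eq_self (fun z => gaussPdf1 0 s z * g (max z 0))]
      simp_rw [hpe]
    have r2 : (∫ z, gaussPdf1 0 s z * g (max z 0)) + ∫ z, gaussPdf1 0 s z * g (max (-z) 0) =
        (∫ z, gaussPdf1 0 s z * g z) + ∫ z, gaussPdf1 0 s z * g 0 := by
      rw [← integral_add (hint _ (by fun_prop)) (hint _ (by fun_prop)),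
        ← integral_add (hint _ (by fun_prop)) (hint (fun _ => 0) (by fun_prop))]
      congr 1; funext z
      rcases le_total z 0 with h | h
      · rw [max_eq_right h, max_eq_left (by linarith), geven]; ring
      · rw [max_eq_left h, max_eq_right (by linarith)]
    have r3 : ∫ z, gaussPdf1 0 s z * g z = A * Real.sqrt (γ' / (γ' + s)) - Real.sqrt (γ / (γ + s)) := by
      rw [hval (fun z => z) (by fun_prop), gauss_exp s γ' hs hγp, gauss_exp s γ hs hγ]
    have r4 : ∫ z, gaussPdf1 0 s z * g 0 = A - 1 := by
      rw [integral_mul_const, gaussPdf1_integral _ _ hs]; simp [hg]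
    rw [r1, r3, r4] at r2
    linarith
  have main : 0 ≤ ∫ z, gaussPdf1 0 s z * g (max z t) := by
    by_cases hcase : 0 ≤ t ∧ 0 ≤ g t
    · refine integral_nonneg fun z => mul_nonneg (gaussPdf1_nonneg _ _ _ hs) ?_
      by_contra hcon
      push Not at hcon
      have := gmono t (max z t) hcase.1 (le_max_right _ _) hcon.le
      linarith [hcase.2]
    · refine G0.trans (integral_mono (hint _ (by fun_prop)) (hint _ (by fun_prop)) fun z => ?_)
      refine mul_le_mul_of_nonneg_left ?_ (gaussPdf1_nonneg _ _ _ hs)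
      rcases le_or_gt 0 t with ht | ht
      · have hgt : g t ≤ 0 := by
          by_contra hcon
          push Not at hcon
          exact hcase ⟨ht, hcon.le⟩
        rcases le_total z t with hz | hz
        · rw [max_eq_right hz]
          exact gmono _ _ (le_max_right _ _) (max_le hz ht) hgt
        · rw [max_eq_left hz, max_eq_left (ht.trans hz)]
      · rcases le_total z 0 with hz | hz
        · rw [max_eq_right hz]; exact gmin _
        · rw [max_eq_left hz, max_eq_left (ht.le.trans hz)]
  rw [hval _ (by fun_prop)] at main
  linarith

lemma A2_deriv (α s k : ℝ) (hα : α ∈ Set.Ioo (-1 : ℝ) 1) (hs : 0 < s) (hk : 0 < k) :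
    ∃ d, 0 < d ∧ HasDerivAt (fun c : ℝ => -1 + Real.sqrt (2 * c ^ (1 - α) / (c ^ 2 * (1 - α) + 1 + α))
      * (1 + Real.sqrt (k * (c ^ 2 * (1 - α) + 1 + α) / (k * (c ^ 2 * (1 - α) + 1 + α) + s)))) d 1 := by
  have h1 : 0 < 1 - α := by linarith [hα.2]
  have hD : HasDerivAt (fun c : ℝ => c ^ 2 * (1 - α) + 1 + α) (2 * (1 - α)) 1 := by
    have := (((hasDerivAt_pow 2 (1 : ℝ)).mul_const (1 - α)).add_const 1).add_const α
    exact this.congr_deriv (by norm_num)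
  have hN : HasDerivAt (fun c : ℝ => 2 * c ^ (1 - α)) (2 * (1 - α)) 1 := by
    have := (Real.hasDerivAt_rpow_const (x := 1) (p := 1 - α) (Or.inl one_ne_zero)).const_mul 2
    exact this.congr_deriv (by simp)
  have v1 : (1 : ℝ) ^ 2 * (1 - α) + 1 + α = 2 := by ring
  have hA := (hN.div hD (by rw [v1]; norm_num)).sqrt (by
    simp only [Pi.div_apply]; rw [v1]; simp)
  have hkD := hD.const_mul k
  have hq := (hkD.div (hkD.add_const s) (by rw [v1]; positivity)).sqrt (by
    simp only [Pi.div_apply]; rw [v1]; positivity)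
  have hfin := (hA.mul (hq.const_add 1)).const_add (-1)
  refine ⟨_, ?_, hfin⟩
  simp only [Pi.div_apply, v1, Real.one_rpow]
  have z : (2 * (1 - α) * 2 - 2 * 1 * (2 * (1 - α))) = 0 := by ring
  rw [z]
  have : k * (2 * (1 - α)) * (k * 2 + s) - k * 2 * (k * (2 * (1 - α))) = k * (2 * (1-α)) * s := by ring
  rw [this]
  simp
  positivity

lemma A2_ge (f : ℝ → ℝ) (v d κ : ℝ) (hd : 0 < d) (hf : HasDerivAt f d 1) (h1 : f 1 = v)
    (hcont : ContinuousOn f (Set.Ici 1)) (hκ : f κ = v)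
    (huniq : ∀ κ' : ℝ, 1 < κ' → f κ' = v → κ' = κ) (c : ℝ) (hc : 1 < c) (hcκ : c ≤ κ) :
    v ≤ f c := by
  by_contra hcon
  push Not at hcon
  have hlt : c < κ := lt_of_le_of_ne hcκ (by rintro rfl; linarith)
  have ev : ∀ᶠ x in nhdsWithin (1 : ℝ) (Set.Ioi 1), 0 < slope f 1 x :=
    ((hasDerivAt_iff_tendsto_slope.1 hf).mono_left
      (nhdsWithin_mono _ (fun x hx => ne_of_gt hx))).eventually_const_lt hd
  obtain ⟨x, hx, hx1, hxc⟩ := (ev.and (Ioo_mem_nhdsGT hc)).exists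
  rw [slope_def_field, div_pos_iff_of_pos_right (by linarith), h1] at hx
  obtain ⟨y, hy, hyv⟩ := intermediate_value_Icc' hxc.le
    (hcont.mono (fun u hu => Set.mem_Ici.2 (hx1.le.trans hu.1)))
    (show v ∈ Set.Icc (f c) (f x) from ⟨hcon.le, by linarith⟩)
  have := huniq y (lt_of_lt_of_le hx1 hy.1) hyv
  linarith [hy.2]

theorem stmt10 (α σX σY : ℝ) (hα : α ∈ Set.Ioo (-1 : ℝ) 1) (hσX : 0 < σX) (hσY : 0 < σY)
    (r : ℝ) (hr : r = σX ^ 2 / σY ^ 2)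
    (γ₀ γ₁ A₁ A₂ : ℝ → ℝ)
    (hγ₀ : ∀ c, γ₀ c = 2 * σY ^ 2 * (c ^ 2 * (1 - α) + 1 + α) / (1 - α ^ 2))
    (hγ₁ : ∀ c, γ₁ c = Real.sqrt (γ₀ c / (γ₀ c + σX ^ 2)))
    (hA₁ : ∀ c, A₁ c = Real.sqrt (2 * c ^ (1 - α) / (c ^ 2 * (1 - α) + 1 + α)))
    (hA₂ : ∀ c, A₂ c = -1 + A₁ c * (1 + γ₁ c))
    (κ : ℝ) (hκ1 : 1 < κ)
    (hκ : A₂ κ = (1 + r * (1 - α ^ 2) / 4) ^ (-(1 : ℝ) / 2))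
    (hκuniq : ∀ κ' : ℝ, 1 < κ' →
      A₂ κ' = (1 + r * (1 - α ^ 2) / 4) ^ (-(1 : ℝ) / 2) → κ' = κ) :
    ∀ c : ℝ, 1 < c → c ≤ κ → ∀ θ : ℝ,
      alphaRisk1 α σX σY (fun x => max x 0) c θ ≤
        alphaRisk1 α σX σY (fun x => max x 0) 1 θ := by
  intro c hc hcκ θ
  have h1 := den_pos α hα
  have hs : 0 < σX ^ 2 := by positivity
  have hs' : 0 < σY ^ 2 := by positivity
  have hk : 0 < 2 * σY ^ 2 / (1 - α ^ 2) := by positivity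
  have hγ0 : ∀ c, γ₀ c = 2 * σY ^ 2 / (1 - α ^ 2) * (c ^ 2 * (1 - α) + 1 + α) := by
    intro c; rw [hγ₀]; ring
  have hγpos : ∀ c, 0 < γ₀ c := fun c => by
    rw [hγ0]; exact mul_pos hk (D_pos α c hα)
  have hA11 : A₁ 1 = 1 := by
    rw [hA₁]
    have : (1 : ℝ) ^ 2 * (1 - α) + 1 + α = 2 := by ring
    rw [this]; simp
  have hv : (1 + r * (1 - α ^ 2) / 4) ^ (-(1 : ℝ) / 2) = γ₁ 1 := by
    have hp : 0 < 1 + r * (1 - α ^ 2) / 4 := by rw [hr]; positivity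
    rw [neg_div, Real.rpow_neg hp.le, ← Real.sqrt_eq_rpow, hγ₁, ← Real.sqrt_inv, hγ₀, hr]
    congr 1
    have : (1 : ℝ) ^ 2 * (1 - α) + 1 + α = 2 := by ring
    rw [this]
    field_simp
    ring
  rw [hv] at hκ hκuniq
  have hA2f : A₂ = (fun c : ℝ => -1 + Real.sqrt (2 * c ^ (1 - α) / (c ^ 2 * (1 - α) + 1 + α))
      * (1 + Real.sqrt (2 * σY ^ 2 / (1 - α ^ 2) * (c ^ 2 * (1 - α) + 1 + α) /
        (2 * σY ^ 2 / (1 - α ^ 2) * (c ^ 2 * (1 - α) + 1 + α) + σX ^ 2)))) := by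
    funext c
    rw [hA₂, hA₁, hγ₁, hγ0]
  obtain ⟨d, hd, hder⟩ := A2_deriv α (σX ^ 2) _ hα hs hk
  rw [← hA2f] at hder
  have hcont : ContinuousOn A₂ (Set.Ici 1) := by
    rw [hA2f]
    intro x hx
    have hx0 : x ≠ 0 := by have : (1 : ℝ) ≤ x := hx; linarith
    have hD := D_pos α x hα
    have hDc : ContinuousAt (fun c : ℝ => c ^ 2 * (1 - α) + 1 + α) x := by fun_prop
    have hNc : ContinuousAt (fun c : ℝ => 2 * c ^ (1 - α)) x :=
      continuousAt_const.mul (Real.continuousAt_rpow_const x _ (Or.inl hx0))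
    have a := (hNc.div hDc hD.ne').sqrt
    have hkc := (continuousAt_const (y := 2 * σY ^ 2 / (1 - α ^ 2))).mul hDc
    have b := (hkc.div (hkc.add (continuousAt_const (y := σX ^ 2)))
      (add_pos (mul_pos hk hD) hs).ne').sqrt
    exact (continuousAt_const.add (a.mul (continuousAt_const.add b))).continuousWithinAt
  have hge := A2_ge A₂ (γ₁ 1) d κ hd hder (by rw [hA₂, hA11]; ring) hcont hκ hκuniq c hc hcκ
  have hc0 : 0 < c := by linarith
  rw [risk_eq α σX σY c θ hα hσX hσY hc0, risk_eq α σX σY 1 θ hα hσX hσY one_pos,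
    ← hγ₀, ← hγ₀, ← hA₁, ← hA₁, hA11, one_mul]
  refine mul_le_mul_of_nonneg_left (sub_le_sub_left ?_ _) (by positivity)
  apply core (σX ^ 2) (γ₀ 1) (γ₀ c) (A₁ c) (-θ) hs (hγpos 1)
  · rw [hγ0, hγ0]
    have : 0 ≤ 1 - α := by linarith [hα.2]
    have h2 : (1 : ℝ) ≤ c := hc.le
    gcongr
  · rw [hA₁]; exact Real.sqrt_nonneg _
  · rw [hA₁]; exact A1_le_one α c hα hc0
  · rw [hA₂, hγ₁, hγ₁] at hge
    linarith
end

section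
/- Let T be a nonnegative real-valued random variable with 0 < E[T] and E[T²] < ∞, and let s > 0. Then E[T e^{-sT}] ≥ E[T] · exp(−s E[T²]/E[T]). -/
open MeasureTheory Real

theorem stmt11 {Ω : Type*} [MeasureSpace Ω] [IsProbabilityMeasure (volume : Measure Ω)]
    (T : Ω → ℝ) (hT0 : ∀ ω, 0 ≤ T ω)
    (hTint : Integrable T) (hT2int : Integrable (fun ω => T ω ^ 2))
    (hTpos : 0 < ∫ ω, T ω)
    (s : ℝ) (hs : 0 < s) :
    (∫ ω, T ω) * Real.exp (-s * (∫ ω, T ω ^ 2) / (∫ ω, T ω)) ≤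
      ∫ ω, T ω * Real.exp (-s * T ω) := by
  set m := ∫ ω, T ω with hm
  set q := ∫ ω, T ω ^ 2 with hq
  set E := Real.exp (-s * q / m) with hE
  have hEpos : 0 < E := Real.exp_pos _
  have hi1 : Integrable (fun ω => (E * (1 + s * q / m)) * T ω) := hTint.const_mul _
  have hi2 : Integrable (fun ω => (E * s) * T ω ^ 2) := hT2int.const_mul _
  have hi3 : Integrable (fun ω => T ω * Real.exp (-s * T ω)) := by
    refine hTint.mono ?_ (Filter.Eventually.of_forall fun ω => ?_)
    · exact hTint.aestronglyMeasurable.mul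
        (Real.continuous_exp.comp_aestronglyMeasurable
          (hTint.aestronglyMeasurable.const_mul (-s)))
    · rw [norm_mul]
      have h1 : ‖Real.exp (-s * T ω)‖ ≤ 1 := by
        rw [Real.norm_eq_abs, abs_of_pos (Real.exp_pos _), Real.exp_le_one_iff]
        nlinarith [mul_nonneg hs.le (hT0 ω)]
      exact mul_le_of_le_one_right (norm_nonneg _) h1
  have key : ∫ ω, ((E * (1 + s * q / m)) * T ω - (E * s) * T ω ^ 2) = m * E := by
    rw [integral_sub hi1 hi2, integral_const_mul, integral_const_mul, ← hm, ← hq]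
    field_simp
    ring
  rw [← key]
  refine integral_mono (hi1.sub hi2) hi3 fun ω => ?_
  have h1 : Real.exp (-s * T ω) = E * Real.exp (s * q / m - s * T ω) := by
    rw [hE, ← Real.exp_add]
    congr 1
    ring
  have h2 := Real.add_one_le_exp (s * q / m - s * T ω)
  have h3 := mul_le_mul_of_nonneg_left h2 (mul_nonneg (hT0 ω) hEpos.le)
  show (E * (1 + s * q / m)) * T ω - (E * s) * T ω ^ 2 ≤ T ω * Real.exp (-s * T ω)
  rw [h1]
  linarith
end

section
/- Let d ≥ 1, α ∈ (-1,1), σ_X, σ_Y > 0, C ⊆ ℝ^d nonempty, and let θ̂ : ℝ^d → ℝ^d be measurable. For θ ∈ C put Z_θ = ‖θ̂(X) − θ‖²/σ_Y² with X ~ N_d(θ, σ_X² I_d), let ε = inf_{θ ∈ C} E_θ[Z_θ · exp(−(1-α²)Z_θ/8)], and assume ε > 0. Set τ = (1-α)ε − 2αd. Then for every c with 1 < c² ≤ (τ + √(τ² + 4d²(1-α²)))/(2d(1-α)), the strict risk inequality R_α(θ, q_{θ̂,c}) < R_α(θ, q_{θ̂,1}) holds for every θ ∈ C; in particular q_{θ̂,c}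 dominates the plug-in density q_{θ̂,1} over C. -/
open MeasureTheory Real

lemma aux_gauss_int (d : ℕ) (μ θ : EuclideanSpace ℝ (Fin d)) (A B : ℝ) (hA : 0 < A) (hB : 0 < B) :
    ∫ y : EuclideanSpace ℝ (Fin d), Real.exp (-A * ‖y - μ‖ ^ 2 - B * ‖y - θ‖ ^ 2)
      = (π / (A + B)) ^ ((d : ℝ) / 2) * Real.exp (-(A * B / (A + B)) * ‖μ - θ‖ ^ 2) := by
  have hAB : 0 < A + B := by positivity
  have key : ∀ y : EuclideanSpace ℝ (Fin d),
      Real.exp (-A * ‖y - μ‖ ^ 2 - B * ‖y - θ‖ ^ 2)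
      = Real.exp (-(A + B) * ‖y - ((A / (A + B)) • μ + (B / (A + B)) • θ)‖ ^ 2)
        * Real.exp (-(A * B / (A + B)) * ‖μ - θ‖ ^ 2) := by
    intro y
    rw [← Real.exp_add]
    congr 1
    have h1 : y - ((A / (A + B)) • μ + (B / (A + B)) • θ)
        = (A / (A + B)) • (y - μ) + (B / (A + B)) • (y - θ) := by
      have : y = (A / (A + B)) • y + (B / (A + B)) • y := by
        rw [← add_smul, ← add_div, div_self hAB.ne', one_smul]
      nth_rewrite 1 [this]
      module
    have h2 : μ - θ = (y - θ) - (y - μ) := by abel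
    rw [h1, h2]
    generalize y - μ = p
    generalize y - θ = q
    rw [@norm_add_sq_real, @norm_sub_sq_real, norm_smul, norm_smul, inner_smul_left,
      inner_smul_right, real_inner_comm]
    simp only [Real.norm_eq_abs, mul_pow, sq_abs, conj_trivial]
    field_simp
    ring
  simp_rw [key]
  rw [integral_mul_const, integral_sub_right_eq_self
    (fun y : EuclideanSpace ℝ (Fin d) => Real.exp (-(A + B) * ‖y‖ ^ 2)),
    GaussianFourier.integral_rexp_neg_mul_sq_norm hAB]
  simp

lemma gaussPdf_eq_exp (d : ℕ) (μ : EuclideanSpace ℝ (Fin d)) (v : ℝ) (hv : 0 < v)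
    (y : EuclideanSpace ℝ (Fin d)) :
    gaussPdf d μ v y = Real.exp (Real.log (2 * π * v) * (-(d : ℝ) / 2) + -‖y - μ‖ ^ 2 / (2 * v)) := by
  rw [gaussPdf, Real.rpow_def_of_pos (by positivity), Real.exp_add]

lemma gaussPdf_integral (d : ℕ) (μ : EuclideanSpace ℝ (Fin d)) (v : ℝ) (hv : 0 < v) :
    ∫ y, gaussPdf d μ v y = 1 := by
  have h := GaussianFourier.integral_rexp_neg_mul_sq_norm (V := EuclideanSpace ℝ (Fin d))
    (b := 1 / (2 * v)) (by positivity)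
  simp only [gaussPdf]
  rw [integral_const_mul, integral_sub_right_eq_self
    (fun y : EuclideanSpace ℝ (Fin d) => Real.exp (-‖y‖ ^ 2 / (2 * v)))]
  have e : (fun y : EuclideanSpace ℝ (Fin d) => Real.exp (-‖y‖ ^ 2 / (2 * v)))
      = fun y => Real.exp (-(1 / (2 * v)) * ‖y‖ ^ 2) := by
    funext y; congr 1; ring
  rw [e, h]
  have e2 : π / (1 / (2 * v)) = 2 * π * v := by field_simp
  rw [e2, ← Real.rpow_add (by positivity)]
  simp [neg_div]

lemma gaussPdf_integrable (d : ℕ) (μ : EuclideanSpace ℝ (Fin d)) (v : ℝ) (hv : 0 < v) :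
    Integrable (gaussPdf d μ v) := by
  apply Integrable.of_integral_ne_zero
  rw [gaussPdf_integral d μ v hv]; norm_num

lemma gaussPdf_pos (d : ℕ) (μ : EuclideanSpace ℝ (Fin d)) (v : ℝ) (hv : 0 < v)
    (y : EuclideanSpace ℝ (Fin d)) : 0 < gaussPdf d μ v y := by
  rw [gaussPdf_eq_exp d μ v hv]; positivity

/-- The closed form of the affinity. -/
noncomputable def affExp (d : ℕ) (a b k z : ℝ) : ℝ :=
  (d : ℝ) / 2 * (b * Real.log k - Real.log (a + b * k)) - a * b * z / (2 * (a + b * k))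

lemma affinity (d : ℕ) (μ θ : EuclideanSpace ℝ (Fin d)) (v k a b : ℝ) (hv : 0 < v) (hk : 0 < k)
    (ha : 0 < a) (hb : 0 < b) (hab : a + b = 1) :
    ∫ y, (gaussPdf d μ (k * v) y / gaussPdf d θ v y) ^ a * gaussPdf d θ v y
      = Real.exp (affExp d a b k (‖μ - θ‖ ^ 2 / v)) := by
  have key : ∀ y, (gaussPdf d μ (k * v) y / gaussPdf d θ v y) ^ a * gaussPdf d θ v y
      = Real.exp ((-(d : ℝ) / 2) * (Real.log (2 * π * v) + a * Real.log k)) *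
        Real.exp (-(a / (2 * (k * v))) * ‖y - μ‖ ^ 2 - (b / (2 * v)) * ‖y - θ‖ ^ 2) := by
    intro y
    rw [gaussPdf_eq_exp d μ _ (by positivity), gaussPdf_eq_exp d θ v hv, ← Real.exp_sub,
      ← Real.exp_mul, ← Real.exp_add, ← Real.exp_add]
    congr 1
    have e : Real.log (2 * π * (k * v)) = Real.log (2 * π * v) + Real.log k := by
      rw [← Real.log_mul (by positivity) (by positivity)]; congr 1; ring
    have hb' : b = 1 - a := by linarith
    rw [e, hb']
    field_simp
    ring
  simp_rw [key]
  have hs : 0 < a + b * k := by positivity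
  rw [integral_const_mul, aux_gauss_int d μ θ _ _ (by positivity) (by positivity)]
  have e2 : π / (a / (2 * (k * v)) + b / (2 * v)) = 2 * π * v * k / (a + b * k) := by
    field_simp
  have e3 : a / (2 * (k * v)) * (b / (2 * v)) / (a / (2 * (k * v)) + b / (2 * v))
      = a * b / (2 * v * (a + b * k)) := by
    field_simp
  rw [e2, e3, Real.rpow_def_of_pos (by positivity), Real.log_div (by positivity) hs.ne',
    Real.log_mul (x := 2 * π * v) (y := k) (by positivity) (by positivity), ← Real.exp_add, ← Real.exp_add, affExp]
  congr 1
  have : a * b * (‖μ - θ‖ ^ 2 / v) / (2 * (a + b * k))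
      = a * b / (2 * v * (a + b * k)) * ‖μ - θ‖ ^ 2 := by field_simp
  rw [this]
  linear_combination (-((d : ℝ) / 2 * Real.log k)) * hab

lemma loss_eq_s12 (d : ℕ) (α : ℝ) (hα : α ∈ Set.Ioo (-1 : ℝ) 1) (μ θ : EuclideanSpace ℝ (Fin d))
    (v k : ℝ) (hv : 0 < v) (hk : 0 < k) :
    alphaLoss d α (gaussPdf d θ v) (gaussPdf d μ (k * v))
      = 4 / (1 - α ^ 2) *
        (1 - Real.exp (affExp d ((1 + α) / 2) ((1 - α) / 2) k (‖μ - θ‖ ^ 2 / v))) := by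
  obtain ⟨h1, h2⟩ := hα
  have hA := affinity d μ θ v k ((1 + α) / 2) ((1 - α) / 2) hv hk (by linarith) (by linarith)
    (by ring)
  have hI : Integrable fun y => (gaussPdf d μ (k * v) y / gaussPdf d θ v y) ^ ((1 + α) / 2)
      * gaussPdf d θ v y := by
    apply Integrable.of_integral_ne_zero
    rw [hA]; positivity
  rw [alphaLoss]
  have e : ∀ y, 4 / (1 - α ^ 2) * (1 - (gaussPdf d μ (k * v) y / gaussPdf d θ v y) ^ ((1 + α) / 2))
      * gaussPdf d θ v y = 4 / (1 - α ^ 2) * (gaussPdf d θ v y -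
      (gaussPdf d μ (k * v) y / gaussPdf d θ v y) ^ ((1 + α) / 2) * gaussPdf d θ v y) := by
    intro y; ring
  simp_rw [e]
  rw [integral_const_mul, integral_sub (gaussPdf_integrable d θ v hv) hI, hA,
    gaussPdf_integral d θ v hv]

/-- The function G. -/
lemma G_pos (D a b ε k : ℝ) (hD : 0 < D) (ha : 0 < a) (hb : 0 < b) (hab : a + b = 1)
    (hk : 1 < k) (hε : 0 < ε) (hq : D * (a + b * k) * (k - 1) ≤ b * ε * k) :
    0 < D / 2 * (b * Real.log k - Real.log (a + b * k))
      + a * b ^ 2 * (k - 1) / (2 * (a + b * k)) * ε := by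
  let G : ℝ → ℝ := fun t => D / 2 * (b * Real.log t - Real.log (a + b * t))
      + a * b ^ 2 * (t - 1) / (2 * (a + b * t)) * ε
  have hder : ∀ t : ℝ, 0 < t → HasDerivAt G
      (D / 2 * (b * t⁻¹ - b / (a + b * t)) +
        (a * b ^ 2 * (2 * (a + b * t)) - a * b ^ 2 * (t - 1) * (2 * b)) / (2 * (a + b * t)) ^ 2 * ε)
      t := by
    intro t ht
    have hs : 0 < a + b * t := by positivity
    have l : HasDerivAt (fun t : ℝ => a + b * t) b t := by
      simpa using ((hasDerivAt_id t).const_mul b).const_add a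
    have l2 : HasDerivAt (fun t : ℝ => 2 * (a + b * t)) (2 * b) t := l.const_mul 2
    have l3 : HasDerivAt (fun t : ℝ => a * b ^ 2 * (t - 1)) (a * b ^ 2) t := by
      simpa using ((hasDerivAt_id t).sub_const 1).const_mul (a * b ^ 2)
    exact ((((Real.hasDerivAt_log ht.ne').const_mul b).sub (l.log hs.ne')).const_mul (D / 2)).add
      ((l3.div l2 (by positivity)).mul_const ε)
  have hm : StrictMonoOn G (Set.Icc 1 k) := by
    apply strictMonoOn_of_deriv_pos (convex_Icc 1 k)
    · intro t ht
      exact (hder t (by linarith [ht.1])).continuousAt.continuousWithinAt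
    · intro t ht
      rw [interior_Icc] at ht
      obtain ⟨h1, h2⟩ := ht
      have ht0 : 0 < t := by linarith
      rw [(hder t ht0).deriv]
      have hs : 0 < a + b * t := by positivity
      have hqt : 0 < b * ε * t - D * (a + b * t) * (t - 1) := by
        have e : (b * ε * t - D * (a + b * t) * (t - 1)) * (k - 1)
            = (k - t) * (b * ε) + (t - 1) * (b * ε * k - D * (a + b * k) * (k - 1))
              + D * b * (t - 1) * (k - t) * (k - 1) := by ring
        have p1 : 0 < (k - t) * (b * ε) := mul_pos (by linarith) (by positivity)
        have p2 : 0 ≤ (t - 1) * (b * ε * k - D * (a + b * k) * (k - 1)) :=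
          mul_nonneg (by linarith) (by linarith)
        have p3 : 0 < D * b * (t - 1) * (k - t) * (k - 1) :=
          mul_pos (mul_pos (mul_pos (by positivity) (by linarith)) (by linarith)) (by linarith)
        exact pos_of_mul_pos_left (by rw [e]; linarith) (by linarith : 0 ≤ k - 1)
      have : D / 2 * (b * t⁻¹ - b / (a + b * t)) +
        (a * b ^ 2 * (2 * (a + b * t)) - a * b ^ 2 * (t - 1) * (2 * b)) / (2 * (a + b * t)) ^ 2 * ε
        = a * b * (b * ε * t - D * (a + b * t) * (t - 1)) / (2 * t * (a + b * t) ^ 2) := by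
        have ha' : a = 1 - b := by linarith
        subst ha'
        field_simp
        ring
      rw [this]
      positivity
  have := hm (Set.left_mem_Icc.2 hk.le) (Set.right_mem_Icc.2 hk.le) hk
  have h0 : G 1 = 0 := by simp [G, hab]
  rw [h0] at this
  exact this

lemma quad_cond (D α ε τ k : ℝ) (hD : 0 < D) (h1 : -1 < α) (h2 : α < 1)
    (hτ : τ = (1 - α) * ε - 2 * α * D) (hk : 1 < k)
    (hle : k ≤ (τ + Real.sqrt (τ ^ 2 + 4 * D ^ 2 * (1 - α ^ 2))) / (2 * D * (1 - α))) :
    D * ((1 + α) / 2 + (1 - α) / 2 * k) * (k - 1) ≤ (1 - α) / 2 * ε * k := by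
  have hα : 0 < 1 - α := by linarith
  have hα' : 0 < 1 + α := by linarith
  have hpos : 0 < 1 - α ^ 2 := by nlinarith
  rw [le_div_iff₀ (by positivity)] at hle
  set S := Real.sqrt (τ ^ 2 + 4 * D ^ 2 * (1 - α ^ 2)) with hS
  have hS2 : S ^ 2 = τ ^ 2 + 4 * D ^ 2 * (1 - α ^ 2) := Real.sq_sqrt (by positivity)
  have hτS : -S < τ := by
    have : 0 ≤ S := Real.sqrt_nonneg _
    have : 0 < 4 * D ^ 2 * (1 - α ^ 2) := by positivity
    exact (abs_lt.1 (abs_lt_of_sq_lt_sq (a := τ) (b := S) (by linarith) (by assumption))).1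
  have hτS' : τ < S := by
    have : 0 ≤ S := Real.sqrt_nonneg _
    have : 0 < 4 * D ^ 2 * (1 - α ^ 2) := by positivity
    exact (abs_lt.1 (abs_lt_of_sq_lt_sq (a := τ) (b := S) (by linarith) (by assumption))).2
  set w := k * (2 * D * (1 - α)) with hw
  have hw0 : 0 < w := by positivity
  have hq : (w - τ - S) * (w - τ + S) ≤ 0 :=
    mul_nonpos_of_nonpos_of_nonneg (by linarith) (by linarith)
  have hq2 : (4 * D * (1 - α)) * (2 * (D * ((1 + α) / 2 + (1 - α) / 2 * k) * (k - 1)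
      - (1 - α) / 2 * ε * k)) = (w - τ - S) * (w - τ + S) := by
    have : (w - τ - S) * (w - τ + S) = (w - τ) ^ 2 - S ^ 2 := by ring
    rw [this, hS2, hw, hτ]
    ring
  have : 0 < 4 * D * (1 - α) := by positivity
  rw [← hq2] at hq
  have := nonpos_of_mul_nonpos_right hq this
  linarith

theorem stmt12 (d : ℕ) (hd : 1 ≤ d) (α : ℝ) (hα : α ∈ Set.Ioo (-1 : ℝ) 1)
    (σX σY : ℝ) (hσX : 0 < σX) (hσY : 0 < σY)
    (C : Set (EuclideanSpace ℝ (Fin d))) (hC : C.Nonempty)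
    (θhat : EuclideanSpace ℝ (Fin d) → EuclideanSpace ℝ (Fin d)) (hmeas : Measurable θhat)
    (ε : ℝ)
    (hε : ε = ⨅ θ : C, ∫ x, gaussPdf d θ (σX ^ 2) x *
        ((‖θhat x - (θ : EuclideanSpace ℝ (Fin d))‖ ^ 2 / σY ^ 2) *
          Real.exp (-(1 - α ^ 2) *
            (‖θhat x - (θ : EuclideanSpace ℝ (Fin d))‖ ^ 2 / σY ^ 2) / 8)))
    (hεpos : 0 < ε)
    (τ : ℝ) (hτ : τ = (1 - α) * ε - 2 * α * d) :
    ∀ c : ℝ, 1 < c ^ 2 →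
      c ^ 2 ≤ (τ + Real.sqrt (τ ^ 2 + 4 * (d : ℝ) ^ 2 * (1 - α ^ 2))) / (2 * d * (1 - α)) →
      (∀ θ ∈ C, alphaRisk d α σX σY θhat c θ < alphaRisk d α σX σY θhat 1 θ) ∧
      ((∀ θ ∈ C, alphaRisk d α σX σY θhat c θ ≤ alphaRisk d α σX σY θhat 1 θ) ∧
        ∃ θ ∈ C, alphaRisk d α σX σY θhat c θ < alphaRisk d α σX σY θhat 1 θ) := by
  intro c hc1 hc2
  obtain ⟨h1, h2⟩ := hα
  have hα : α ∈ Set.Ioo (-1 : ℝ) 1 := ⟨h1, h2⟩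
  have hD : (0 : ℝ) < d := by exact_mod_cast hd
  have hpos : 0 < 1 - α ^ 2 := by nlinarith
  have hq := quad_cond d α ε τ (c ^ 2) hD h1 h2 hτ hc1 hc2
  have hG := G_pos d ((1 + α) / 2) ((1 - α) / 2) ε (c ^ 2) hD (by linarith) (by linarith)
    (by ring) hc1 hεpos hq
  have main : ∀ θ ∈ C, alphaRisk d α σX σY θhat c θ < alphaRisk d α σX σY θhat 1 θ := by
    intro θ hθ
    have hvX : 0 < σX ^ 2 := by positivity
    have hvY : 0 < σY ^ 2 := by positivity
    set a := (1 + α) / 2 with ha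
    set b := (1 - α) / 2 with hb
    have ha0 : 0 < a := by linarith
    have hb0 : 0 < b := by linarith
    have hab : a + b = 1 := by rw [ha, hb]; ring
    have hs : 0 < a + b * c ^ 2 := by positivity
    have hs1 : 1 ≤ a + b * c ^ 2 := by nlinarith
    set g := gaussPdf d θ (σX ^ 2) with hg
    set Z : EuclideanSpace ℝ (Fin d) → ℝ := fun x => ‖θhat x - θ‖ ^ 2 / σY ^ 2 with hZ
    have hZm : Measurable Z := by fun_prop
    have hZ0 : ∀ x, 0 ≤ Z x := fun x => by positivity
    have hg0 : ∀ x, 0 < g x := gaussPdf_pos d θ _ hvX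
    have hgI : Integrable g := gaussPdf_integrable d θ _ hvX
    have hg1 : ∫ x, g x = 1 := gaussPdf_integral d θ _ hvX
    have hεle : ε ≤ ∫ x, g x * (Z x * Real.exp (-(1 - α ^ 2) * Z x / 8)) := by
      rw [hε]
      refine ciInf_le (f := fun θ : C => ∫ x, gaussPdf d θ (σX ^ 2) x *
        ((‖θhat x - (θ : EuclideanSpace ℝ (Fin d))‖ ^ 2 / σY ^ 2) *
          Real.exp (-(1 - α ^ 2) *
            (‖θhat x - (θ : EuclideanSpace ℝ (Fin d))‖ ^ 2 / σY ^ 2) / 8))) ⟨0, ?_⟩ ⟨θ, hθ⟩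
      rintro _ ⟨t, rfl⟩
      apply integral_nonneg
      intro x
      have := gaussPdf_pos d t _ hvX x
      simp only [Pi.zero_apply]
      positivity
    have hZI : Integrable fun x => g x * (Z x * Real.exp (-(1 - α ^ 2) * Z x / 8)) := by
      apply Integrable.of_integral_ne_zero
      linarith
    -- boundedness of the affinity
    have hEI : ∀ k, 0 < k → Integrable fun x => g x * Real.exp (affExp d a b k (Z x)) := by
      intro k hk
      have hsk : 0 < a + b * k := by positivity
      refine hgI.mul_bdd (c := Real.exp ((d : ℝ) / 2 * (b * Real.log k - Real.log (a + b * k)))) ?_ ?_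
      · apply Measurable.aestronglyMeasurable
        unfold affExp
        fun_prop
      · refine Filter.Eventually.of_forall fun x => ?_
        rw [Real.norm_eq_abs, abs_of_pos (Real.exp_pos _)]
        apply Real.exp_le_exp.2
        unfold affExp
        have : 0 ≤ a * b * Z x / (2 * (a + b * k)) := by
          have := hZ0 x
          positivity
        linarith
    have hrisk : ∀ c' : ℝ, 0 < c' ^ 2 → alphaRisk d α σX σY θhat c' θ
        = 4 / (1 - α ^ 2) * (1 - ∫ x, g x * Real.exp (affExp d a b (c' ^ 2) (Z x))) := by
      intro c' hc'
      rw [alphaRisk]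
      have e : ∀ x, gaussPdf d θ (σX ^ 2) x * alphaLoss d α (gaussPdf d θ (σY ^ 2))
          (gaussPdf d (θhat x) (c' ^ 2 * σY ^ 2)) =
          4 / (1 - α ^ 2) * (g x - g x * Real.exp (affExp d a b (c' ^ 2) (Z x))) := by
        intro x
        rw [loss_eq_s12 d α hα _ _ _ _ hvY hc']
        ring
      simp_rw [e]
      rw [integral_const_mul, integral_sub hgI (hEI _ hc'), hg1]
    have h1e : ∀ z, affExp d a b (1 ^ 2) z = -(1 - α ^ 2) * z / 8 := by
      intro z
      have : a * b = (1 - α ^ 2) / 4 := by rw [ha, hb]; ring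
      simp [affExp, hab, this]
      ring
    have hEI1 := hEI (1 ^ 2) (by norm_num)
    have hEIc := hEI (c ^ 2) (by linarith)
    rw [hrisk c (by linarith), hrisk 1 (by norm_num)]
    apply mul_lt_mul_of_pos_left _ (by positivity)
    apply sub_lt_sub_left
    set K := (d : ℝ) / 2 * (b * Real.log (c ^ 2) - Real.log (a + b * c ^ 2)) with hK
    set M := a * b ^ 2 * (c ^ 2 - 1) / (2 * (a + b * c ^ 2)) with hM
    have hM0 : 0 ≤ M := by
      have : 0 ≤ c ^ 2 - 1 := by linarith
      positivity
    have hK0 : K ≤ 0 := by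
      have := strictConcaveOn_log_Ioi.concaveOn.2 (Set.mem_Ioi.2 (by linarith : (0:ℝ) < 1))
        (Set.mem_Ioi.2 (by linarith : (0:ℝ) < c ^ 2)) ha0.le hb0.le hab
      simp only [smul_eq_mul, Real.log_one, mul_zero, mul_one, zero_add] at this
      apply mul_nonpos_of_nonneg_of_nonpos (by positivity)
      linarith
    have hpt : ∀ x, g x * Real.exp (affExp d a b (1 ^ 2) (Z x)) + (g x * K +
        M * (g x * (Z x * Real.exp (-(1 - α ^ 2) * Z x / 8))))
        ≤ g x * Real.exp (affExp d a b (c ^ 2) (Z x)) := by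
      intro x
      have hd : affExp d a b (c ^ 2) (Z x) = affExp d a b (1 ^ 2) (Z x) + (K + M * Z x) := by
        simp only [affExp, hK, hM, one_pow, Real.log_one, mul_one, hab]
        have ha' : a = 1 - b := by linarith
        rw [ha'] at hs ⊢
        field_simp
        ring
      rw [hd, Real.exp_add, h1e]
      set E := Real.exp (-(1 - α ^ 2) * Z x / 8) with hE
      have hE0 : 0 < E := Real.exp_pos _
      have hE1 : E ≤ 1 := by
        apply Real.exp_le_one_iff.2
        have := mul_nonneg hpos.le (hZ0 x)
        linarith
      have h3 := Real.add_one_le_exp (K + M * Z x)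
      have h4 : E * (K + M * Z x + 1) ≤ E * Real.exp (K + M * Z x) :=
        mul_le_mul_of_nonneg_left h3 hE0.le
      have h5 : K ≤ E * K := by nlinarith
      have h6 : E + (K + M * (Z x * E)) ≤ E * Real.exp (K + M * Z x) := by linarith
      have h7 := mul_le_mul_of_nonneg_left h6 (hg0 x).le
      linarith
    have hKM : Integrable fun x => g x * K +
        M * (g x * (Z x * Real.exp (-(1 - α ^ 2) * Z x / 8))) :=
      (hgI.mul_const K).add (hZI.const_mul M)
    have hint : (∫ x, (g x * Real.exp (affExp d a b (1 ^ 2) (Z x)) + (g x * K +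
        M * (g x * (Z x * Real.exp (-(1 - α ^ 2) * Z x / 8))))))
        ≤ ∫ x, g x * Real.exp (affExp d a b (c ^ 2) (Z x)) :=
      integral_mono (hEI1.add hKM) hEIc hpt
    have hsum : (∫ x, (g x * Real.exp (affExp d a b (1 ^ 2) (Z x)) + (g x * K +
        M * (g x * (Z x * Real.exp (-(1 - α ^ 2) * Z x / 8))))))
        = (∫ x, g x * Real.exp (affExp d a b (1 ^ 2) (Z x))) + (K +
        M * ∫ x, (g x * (Z x * Real.exp (-(1 - α ^ 2) * Z x / 8)))) := by
      rw [integral_add hEI1 hKM,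
        integral_add (hgI.mul_const K) (hZI.const_mul M), integral_mul_const, integral_const_mul,
        hg1, one_mul]
    rw [hsum] at hint
    have hMε := mul_le_mul_of_nonneg_left hεle hM0
    have fin : ∀ I1 Ic W : ℝ, I1 + (K + W) ≤ Ic → M * ε ≤ W → I1 < Ic := by
      intro I1 Ic W u1 u2
      clear_value K M
      linarith
    exact fin _ _ _ hint hMε
  refine ⟨main, fun θ hθ => (main θ hθ).le, ?_⟩
  obtain ⟨θ, hθ⟩ := hC
  exact ⟨θ, hθ, main θ hθ⟩
end

section
/- Let d ≥ 1, α ∈ (-1,1), σ_X, σ_Y > 0, C ⊆ ℝ^d nonempty, θ̂ : ℝ^d → ℝ^d measurable, and for θ ∈ C put Z_θ = ‖θ̂(X) − θ‖²/σ_Y² with X ~ N_d(θ, σ_X² I_d). Suppose there exist b₀, b₁, b₂ > 0 such that b₀σ_Y² ≤ E_θ‖θ̂(X) − θ‖² ≤ b₁σ_Y² and E_θ‖θ̂(X) − θ‖⁴ ≤ b₂σ_Y⁴ for all θ ∈ C. Then ε = inf_{θ ∈ C} E_θ[Z_θ exp(−(1-α²)Z_θ/8)] satisfies ε ≥ b₀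 exp(−(1-α²)b₂/(8b₀)) > 0, and consequently the dominance cut-off k = (τ + √(τ² + 4d²(1-α²)))/(2d(1-α)) with τ = (1-α)ε − 2αd satisfies k ≥ (τ̲ + √(τ̲² + 4d²(1-α²)))/(2d(1-α)), where τ̲ = (1-α) b₀ exp(−(1-α²)b₂/(8b₀)) − 2αd. -/
open MeasureTheory Real

lemma aux_mono_s13 (a b K : ℝ) (hK : 0 ≤ K) (hab : a ≤ b) :
    a + Real.sqrt (a ^ 2 + K) ≤ b + Real.sqrt (b ^ 2 + K) := by
  have ht0 := Real.sqrt_nonneg (b ^ 2 + K)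
  have ht2 := Real.sq_sqrt (show 0 ≤ b ^ 2 + K by positivity)
  have htb : |b| ≤ Real.sqrt (b ^ 2 + K) := Real.abs_le_sqrt (by linarith)
  have htb' := (abs_le.1 htb).1
  have h : Real.sqrt (a ^ 2 + K) ≤ (b - a) + Real.sqrt (b ^ 2 + K) := by
    rw [Real.sqrt_le_iff]
    refine ⟨by linarith, ?_⟩
    nlinarith [mul_nonneg (sub_nonneg.2 hab)
      (show 0 ≤ b + Real.sqrt (b ^ 2 + K) by linarith)]
  linarith

lemma aux_point (c m z : ℝ) (hz : 0 ≤ z) :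
    Real.exp (-c * m) * ((1 + c * m) * z - c * z ^ 2) ≤ z * Real.exp (-c * z) := by
  have h1 := Real.add_one_le_exp (c * m - c * z)
  have h2 : Real.exp (-c * z) = Real.exp (-c * m) * Real.exp (c * m - c * z) := by
    rw [← Real.exp_add]; congr 1; ring
  rw [h2]
  have := mul_le_mul_of_nonneg_left h1 (mul_nonneg (Real.exp_pos (-c * m)).le hz)
  nlinarith

lemma aux_int {E : Type*} [MeasurableSpace E] (μ : Measure E) (p n : E → ℝ)
    (hp : ∀ x, 0 ≤ p x) (hpm : Measurable p) (hnm : Measurable n)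
    (s c b₀ b₂ : ℝ) (hs : 0 < s) (hc : 0 ≤ c) (hb₀ : 0 < b₀) (hb₂ : 0 < b₂)
    (h2 : Integrable (fun x => p x * n x ^ 2) μ) (h4 : Integrable (fun x => p x * n x ^ 4) μ)
    (hl : b₀ * s ^ 2 ≤ ∫ x, p x * n x ^ 2 ∂μ) (hu : ∫ x, p x * n x ^ 4 ∂μ ≤ b₂ * s ^ 4) :
    b₀ * Real.exp (-c * (b₂ / b₀)) ≤
      ∫ x, p x * ((n x ^ 2 / s ^ 2) * Real.exp (-c * (n x ^ 2 / s ^ 2))) ∂μ := by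
  set e := Real.exp (-c * (b₂ / b₀)) with he
  have hepos : 0 < e := Real.exp_pos _
  have hint : Integrable
      (fun x => p x * ((n x ^ 2 / s ^ 2) * Real.exp (-c * (n x ^ 2 / s ^ 2)))) μ := by
    refine (h2.div_const (s ^ 2)).mono' (by fun_prop) (Filter.Eventually.of_forall fun x => ?_)
    have hz : 0 ≤ n x ^ 2 / s ^ 2 := by positivity
    have hx := hp x
    rw [Real.norm_of_nonneg (by positivity), mul_div_assoc]
    refine mul_le_mul_of_nonneg_left (mul_le_of_le_one_right hz ?_) hx
    rw [Real.exp_le_one_iff]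
    nlinarith [mul_nonneg hc hz]
  have hA := h2.const_mul (e * (1 + c * (b₂ / b₀)) / s ^ 2)
  have hB := h4.const_mul (e * c / s ^ 4)
  have key := integral_mono (hA.sub hB) hint (fun x => by
    have := mul_le_mul_of_nonneg_left
      (aux_point c (b₂ / b₀) (n x ^ 2 / s ^ 2) (by positivity)) (hp x)
    refine le_trans (le_of_eq ?_) this
    simp only [Pi.sub_apply, ← he]
    field_simp)
  simp only [Pi.sub_apply] at key
  rw [integral_sub hA hB, integral_const_mul, integral_const_mul] at key
  refine le_trans ?_ key
  have k1 := mul_le_mul_of_nonneg_left hl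
    (show 0 ≤ e * (1 + c * (b₂ / b₀)) / s ^ 2 by positivity)
  have k2 := mul_le_mul_of_nonneg_left hu (show 0 ≤ e * c / s ^ 4 by positivity)
  have e1 : e * (1 + c * (b₂ / b₀)) / s ^ 2 * (b₀ * s ^ 2) = e * b₀ + e * c * b₂ := by
    field_simp
  have e2 : e * c / s ^ 4 * (b₂ * s ^ 4) = e * c * b₂ := by field_simp
  rw [e1] at k1
  rw [e2] at k2
  linarith

theorem stmt13 (d : ℕ) (hd : 1 ≤ d) (α : ℝ) (hα : α ∈ Set.Ioo (-1 : ℝ) 1)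
    (σX σY : ℝ) (hσX : 0 < σX) (hσY : 0 < σY)
    (C : Set (EuclideanSpace ℝ (Fin d))) (hC : C.Nonempty)
    (θhat : EuclideanSpace ℝ (Fin d) → EuclideanSpace ℝ (Fin d)) (hmeas : Measurable θhat)
    (b₀ b₁ b₂ : ℝ) (hb₀ : 0 < b₀) (hb₁ : 0 < b₁) (hb₂ : 0 < b₂)
    (hint2 : ∀ θ ∈ C, Integrable
      (fun x => gaussPdf d θ (σX ^ 2) x * ‖θhat x - θ‖ ^ 2))
    (hint4 : ∀ θ ∈ C, Integrable
      (fun x => gaussPdf d θ (σX ^ 2) x * ‖θhat x - θ‖ ^ 4))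
    (hlow : ∀ θ ∈ C, b₀ * σY ^ 2 ≤ ∫ x, gaussPdf d θ (σX ^ 2) x * ‖θhat x - θ‖ ^ 2)
    (hup : ∀ θ ∈ C, (∫ x, gaussPdf d θ (σX ^ 2) x * ‖θhat x - θ‖ ^ 2) ≤ b₁ * σY ^ 2)
    (hup4 : ∀ θ ∈ C, (∫ x, gaussPdf d θ (σX ^ 2) x * ‖θhat x - θ‖ ^ 4) ≤ b₂ * σY ^ 4)
    (ε : ℝ)
    (hε : ε = ⨅ θ : C, ∫ x, gaussPdf d θ (σX ^ 2) x *
        ((‖θhat x - (θ : EuclideanSpace ℝ (Fin d))‖ ^ 2 / σY ^ 2) *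
          Real.exp (-(1 - α ^ 2) *
            (‖θhat x - (θ : EuclideanSpace ℝ (Fin d))‖ ^ 2 / σY ^ 2) / 8)))
    (τ τlow : ℝ) (hτ : τ = (1 - α) * ε - 2 * α * d)
    (hτlow : τlow = (1 - α) * b₀ * Real.exp (-(1 - α ^ 2) * b₂ / (8 * b₀)) - 2 * α * d) :
    b₀ * Real.exp (-(1 - α ^ 2) * b₂ / (8 * b₀)) ≤ ε ∧ 0 < ε ∧
      (τlow + Real.sqrt (τlow ^ 2 + 4 * (d : ℝ) ^ 2 * (1 - α ^ 2))) / (2 * d * (1 - α)) ≤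
        (τ + Real.sqrt (τ ^ 2 + 4 * (d : ℝ) ^ 2 * (1 - α ^ 2))) / (2 * d * (1 - α)) := by
  obtain ⟨ha1, ha2⟩ := hα
  have hc : 0 ≤ 1 - α ^ 2 := by nlinarith
  have hmain : b₀ * Real.exp (-(1 - α ^ 2) * b₂ / (8 * b₀)) ≤ ε := by
    rw [hε]
    have : Nonempty C := hC.to_subtype
    refine le_ciInf fun θ => ?_
    have h := aux_int volume (gaussPdf d θ (σX ^ 2)) (fun x => ‖θhat x - θ‖)
      (fun x => by unfold gaussPdf; positivity)
      (by unfold gaussPdf; fun_prop) (by fun_prop) σY ((1 - α ^ 2) / 8) b₀ b₂ hσY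
      (by positivity) hb₀ hb₂ (hint2 θ θ.2) (hint4 θ θ.2) (hlow θ θ.2) (hup4 θ θ.2)
    have q1 : -(1 - α ^ 2) * b₂ / (8 * b₀) = -((1 - α ^ 2) / 8) * (b₂ / b₀) := by
      field_simp
    have q2 : ∀ z : ℝ, -(1 - α ^ 2) * z / 8 = -((1 - α ^ 2) / 8) * z := fun z => by ring
    rw [q1]
    simp only [q2]
    exact h
  refine ⟨hmain, lt_of_lt_of_le (by positivity) hmain, ?_⟩
  have h1 : 0 < 1 - α := by linarith
  have hτ' : τlow ≤ τ := by
    rw [hτ, hτlow, mul_assoc]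
    have := mul_le_mul_of_nonneg_left hmain h1.le
    linarith
  have := aux_mono_s13 τlow τ (4 * (d : ℝ) ^ 2 * (1 - α ^ 2)) (by positivity) hτ'
  exact div_le_div_of_nonneg_right this (by positivity)
end

section
/- Let d ≥ 1, σ_X, σ_Y > 0, C ⊆ ℝ^d nonempty, and θ̂ : ℝ^d → ℝ^d measurable. For α ∈ [-1, 1) define ε(α) = inf_{θ ∈ C} E_θ[Z_θ exp(−(1-α²)Z_θ/8)] with Z_θ = ‖θ̂(X) − θ‖²/σ_Y² and X ~ N_d(θ, σ_X² I_d), τ(α) = (1-α)ε(α) − 2αd, and k(α) = (τ(α) + √(τ(α)² + 4d²(1-α²)))/(2d(1-α)); note k(-1) = 1 + ε(-1)/d. Assume 0 < ε(0) and ε(-1) < ∞. Then k(-1) ≥ k(0); that is, the Kullback–Leibler cut-off is at least the Hellinger cut-off. -/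
open MeasureTheory Real

theorem stmt16 (d : ℕ) (hd : 1 ≤ d) (σX σY : ℝ) (hσX : 0 < σX) (hσY : 0 < σY)
    (C : Set (EuclideanSpace ℝ (Fin d))) (hC : C.Nonempty)
    (θhat : EuclideanSpace ℝ (Fin d) → EuclideanSpace ℝ (Fin d)) (hmeas : Measurable θhat)
    (ε τ k : ℝ → ℝ)
    (hε : ∀ α : ℝ, ε α = ⨅ θ : C, ∫ x, gaussPdf d θ (σX ^ 2) x *
        ((‖θhat x - (θ : EuclideanSpace ℝ (Fin d))‖ ^ 2 / σY ^ 2) *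
          Real.exp (-(1 - α ^ 2) *
            (‖θhat x - (θ : EuclideanSpace ℝ (Fin d))‖ ^ 2 / σY ^ 2) / 8)))
    (hτ : ∀ α : ℝ, τ α = (1 - α) * ε α - 2 * α * d)
    (hk : ∀ α : ℝ, k α =
      (τ α + Real.sqrt (τ α ^ 2 + 4 * (d : ℝ) ^ 2 * (1 - α ^ 2))) / (2 * d * (1 - α)))
    (hε0 : 0 < ε 0)
    (hεKLfin : ∀ θ ∈ C, Integrable
      (fun x => gaussPdf d θ (σX ^ 2) x * (‖θhat x - θ‖ ^ 2 / σY ^ 2))) :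
    k (-1) = 1 + ε (-1) / d ∧ k 0 ≤ k (-1) := by
  have hdpos : (0 : ℝ) < d := by exact_mod_cast hd
  have hg : ∀ (θ x : EuclideanSpace ℝ (Fin d)), 0 ≤ gaussPdf d θ (σX ^ 2) x := by
    intro θ x
    unfold gaussPdf
    positivity
  have hmono : ε 0 ≤ ε (-1) := by
    rw [hε 0, hε (-1)]
    apply ciInf_mono
    · refine ⟨0, ?_⟩
      rintro _ ⟨θ, rfl⟩
      exact integral_nonneg fun x => mul_nonneg (hg _ _) (by positivity)
    · intro θ
      apply integral_mono_of_nonneg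
      · exact Filter.Eventually.of_forall fun x => mul_nonneg (hg _ _) (by positivity)
      · simpa using hεKLfin θ θ.2
      · refine Filter.Eventually.of_forall fun x => ?_
        refine mul_le_mul_of_nonneg_left ?_ (hg _ _)
        refine mul_le_mul_of_nonneg_left ?_ (by positivity)
        apply Real.exp_le_exp.mpr
        have : 0 ≤ ‖θhat x - (θ : EuclideanSpace ℝ (Fin d))‖ ^ 2 / σY ^ 2 := by positivity
        linarith
  have hk1 : k (-1) = 1 + ε (-1) / d := by
    have h1 : τ (-1) = 2 * ε (-1) + 2 * d := by rw [hτ]; ring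
    have h2 : τ (-1) ^ 2 + 4 * (d : ℝ) ^ 2 * (1 - (-1) ^ 2) = τ (-1) ^ 2 := by ring
    rw [hk, h2, Real.sqrt_sq (by rw [h1]; linarith), h1]
    field_simp
    ring
  refine ⟨hk1, ?_⟩
  have h0 : τ 0 = ε 0 := by rw [hτ]; ring
  have hs : Real.sqrt (τ 0 ^ 2 + 4 * (d : ℝ) ^ 2 * (1 - 0 ^ 2)) ≤ ε 0 + 2 * d := by
    rw [h0]
    apply Real.sqrt_le_iff.mpr
    constructor
    · positivity
    · nlinarith [mul_pos hε0 hdpos]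
  rw [hk1, hk 0, div_le_iff₀ (by linarith)]
  have h3 : (1 + ε (-1) / d) * (2 * d * (1 - 0)) = 2 * d + 2 * ε (-1) := by
    field_simp
    ring
  rw [h3]
  linarith
end

section
/- Let d ≥ 1, σ_X, σ_Y > 0, C ⊆ ℝ^d nonempty, and θ̂ : ℝ^d → ℝ^d measurable. For α ∈ [-1, 0] define ε(α) = inf_{θ ∈ C} E_θ[Z_θ exp(−(1-α²)Z_θ/8)] with Z_θ = ‖θ̂(X) − θ‖²/σ_Y² and X ~ N_d(θ, σ_X² I_d), τ(α) = (1-α)ε(α) − 2αd, and k(α) = (τ(α) + √(τ(α)² + 4d²(1-α²)))/(2d(1-α)). Assume 0 < ε(0) and ε(-1) < ∞. Then α ↦ k(α) is non-increasing on [-1, 0]. -/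
open MeasureTheory Real

theorem root_facts (d e a t k : ℝ) (hd : 0 < d) (he : 0 ≤ e) (ha : a ∈ Set.Icc (-1 : ℝ) 0)
    (ht : t = (1 - a) * e - 2 * a * d)
    (hk : k = (t + Real.sqrt (t ^ 2 + 4 * d ^ 2 * (1 - a ^ 2))) / (2 * d * (1 - a))) :
    1 ≤ k ∧ d * (1 - a) * k ^ 2 - t * k - d * (1 + a) = 0 := by
  obtain ⟨h1, h0⟩ := ha
  have hD : 0 ≤ t ^ 2 + 4 * d ^ 2 * (1 - a ^ 2) := by
    have : 0 ≤ 1 - a ^ 2 := by nlinarith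
    positivity
  have ht0 : 0 ≤ t := by
    rw [ht]
    nlinarith [mul_nonneg (by linarith : 0 ≤ 1 - a) he, mul_nonneg (by linarith : 0 ≤ -a) hd.le]
  have hs := Real.sq_sqrt hD
  have hs0 := Real.sqrt_nonneg (t ^ 2 + 4 * d ^ 2 * (1 - a ^ 2))
  set s := Real.sqrt (t ^ 2 + 4 * d ^ 2 * (1 - a ^ 2)) with hsdef
  have h1a : 0 < 1 - a := by linarith
  have hden : 0 < 2 * d * (1 - a) := by positivity
  have hk2 : k * (2 * d * (1 - a)) = t + s := by
    rw [hk]; field_simp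
  have hseq : s = k * (2 * d * (1 - a)) - t := by linarith
  have hk0 : 0 ≤ k := by rw [hk]; positivity
  have hpoly : d * (1 - a) * k ^ 2 - t * k - d * (1 + a) = 0 := by
    rw [hseq] at hs
    have : (4 * d * (1 - a)) * (d * (1 - a) * k ^ 2 - t * k - d * (1 + a)) = 0 := by
      linear_combination hs
    rcases mul_eq_zero.mp this with h | h
    · exfalso; nlinarith
    · exact h
  refine ⟨?_, hpoly⟩
  have hkpos : 0 < k * (1 - a) + (1 + a) := by
    rcases eq_or_lt_of_le h1 with h | h
    · subst h
      have : 0 < t := by rw [ht]; linarith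
      have : 0 < k := by rw [hk]; positivity
      linarith
    · have := mul_nonneg hk0 h1a.le
      linarith
  have hfac : d * (k - 1) * (k * (1 - a) + (1 + a)) = (1 - a) * e * k := by
    rw [ht] at hpoly
    linear_combination hpoly
  by_contra hlt
  push Not at hlt
  have h2 : 0 ≤ (1 - a) * e * k := by positivity
  have h3 : 0 < d * (1 - k) * (k * (1 - a) + (1 + a)) := by
    have : 0 < 1 - k := by linarith
    positivity
  nlinarith

theorem root_mono (d ea eb a b x y : ℝ) (hd : 0 < d) (heb : 0 ≤ eb) (hee : eb ≤ ea)
    (ha : -1 ≤ a) (hb : b ≤ 0) (hab : a ≤ b) (hx : 1 ≤ x) (hy : 1 ≤ y)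
    (hpx : d * (1 - a) * x ^ 2 - ((1 - a) * ea - 2 * a * d) * x - d * (1 + a) = 0)
    (hpy : d * (1 - b) * y ^ 2 - ((1 - b) * eb - 2 * b * d) * y - d * (1 + b) = 0) :
    y ≤ x := by
  have h1a : 0 < 1 - a := by linarith
  have h1b : 0 < 1 - b := by linarith
  by_contra hlt
  push Not at hlt
  set tb := (1 - b) * eb - 2 * b * d with htb
  have key : 0 ≤ (1 - a) * (d * (1 - b) * x ^ 2 - tb * x - d * (1 + b)) := by
    have e : (1 - a) * (d * (1 - b) * x ^ 2 - tb * x - d * (1 + b))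
        = (1 - a) * (1 - b) * (ea - eb) * x + 2 * d * (b - a) * (x - 1) := by
      rw [htb]; linear_combination (1 - b) * hpx
    rw [e]
    have : 0 ≤ ea - eb := by linarith
    have : 0 ≤ b - a := by linarith
    have : 0 ≤ x - 1 := by linarith
    positivity
  have key2 : 0 ≤ d * (1 - b) * x ^ 2 - tb * x - d * (1 + b) := by
    by_contra h
    push Not at h
    nlinarith
  have h3 : 0 ≤ (x - y) * (d * (1 - b) * (x + y) - tb) := by
    have : (x - y) * (d * (1 - b) * (x + y) - tb)
      = d * (1 - b) * x ^ 2 - tb * x - d * (1 + b) := by linear_combination -hpy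
    rw [this]; exact key2
  have h4 : 0 ≤ d * (1 - b) * y - tb := by
    have h5 : (d * (1 - b) * y - tb) * y = d * (1 + b) := by linear_combination hpy
    have h6 : 0 ≤ d * (1 + b) := mul_nonneg hd.le (by linarith)
    by_contra h
    push Not at h
    nlinarith
  have h7 : 0 < d * (1 - b) * x := by positivity
  nlinarith

theorem gaussPdf_nonneg' (d : ℕ) (μ : EuclideanSpace ℝ (Fin d)) (v : ℝ) (hv : 0 ≤ v)
    (y : EuclideanSpace ℝ (Fin d)) : 0 ≤ gaussPdf d μ v y := by
  unfold gaussPdf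
  have := Real.pi_pos
  positivity

theorem stmt17 (d : ℕ) (hd : 1 ≤ d) (σX σY : ℝ) (hσX : 0 < σX) (hσY : 0 < σY)
    (C : Set (EuclideanSpace ℝ (Fin d))) (hC : C.Nonempty)
    (θhat : EuclideanSpace ℝ (Fin d) → EuclideanSpace ℝ (Fin d)) (hmeas : Measurable θhat)
    (ε τ k : ℝ → ℝ)
    (hε : ∀ α : ℝ, ε α = ⨅ θ : C, ∫ x, gaussPdf d θ (σX ^ 2) x *
        ((‖θhat x - (θ : EuclideanSpace ℝ (Fin d))‖ ^ 2 / σY ^ 2) *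
          Real.exp (-(1 - α ^ 2) *
            (‖θhat x - (θ : EuclideanSpace ℝ (Fin d))‖ ^ 2 / σY ^ 2) / 8)))
    (hτ : ∀ α : ℝ, τ α = (1 - α) * ε α - 2 * α * d)
    (hk : ∀ α : ℝ, k α =
      (τ α + Real.sqrt (τ α ^ 2 + 4 * (d : ℝ) ^ 2 * (1 - α ^ 2))) / (2 * d * (1 - α)))
    (hε0 : 0 < ε 0)
    (hεKLfin : ∀ θ ∈ C, Integrable
      (fun x => gaussPdf d θ (σX ^ 2) x * (‖θhat x - θ‖ ^ 2 / σY ^ 2))) :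
    AntitoneOn k (Set.Icc (-1 : ℝ) 0) := by
  have hd0 : (0 : ℝ) < d := by exact_mod_cast hd
  haveI : Nonempty C := hC.to_subtype
  have hg : ∀ (θ x : EuclideanSpace ℝ (Fin d)), 0 ≤ gaussPdf d θ (σX ^ 2) x :=
    fun θ x => gaussPdf_nonneg' d θ _ (by positivity) x
  have hnn : ∀ (α : ℝ) (θ : C), 0 ≤ ∫ x, gaussPdf d θ (σX ^ 2) x *
        ((‖θhat x - (θ : EuclideanSpace ℝ (Fin d))‖ ^ 2 / σY ^ 2) *
          Real.exp (-(1 - α ^ 2) *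
            (‖θhat x - (θ : EuclideanSpace ℝ (Fin d))‖ ^ 2 / σY ^ 2) / 8)) := by
    intro α θ
    apply integral_nonneg
    intro x
    have := hg θ x
    simp only [Pi.zero_apply]
    positivity
  have hεnn : ∀ α, 0 ≤ ε α := by
    intro α
    rw [hε]
    exact Real.iInf_nonneg (hnn α)
  have hint : ∀ α ∈ Set.Icc (-1 : ℝ) 0, ∀ θ : C, Integrable (fun x => gaussPdf d θ (σX ^ 2) x *
        ((‖θhat x - (θ : EuclideanSpace ℝ (Fin d))‖ ^ 2 / σY ^ 2) *
          Real.exp (-(1 - α ^ 2) *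
            (‖θhat x - (θ : EuclideanSpace ℝ (Fin d))‖ ^ 2 / σY ^ 2) / 8))) := by
    intro α hα θ
    refine (hεKLfin θ θ.2).mono' ?_ ?_
    · apply Measurable.aestronglyMeasurable
      unfold gaussPdf
      fun_prop
    · refine Filter.Eventually.of_forall fun x => ?_
      have h0 := hg θ x
      have hz : 0 ≤ ‖θhat x - (θ : EuclideanSpace ℝ (Fin d))‖ ^ 2 / σY ^ 2 := by positivity
      rw [Real.norm_of_nonneg (by positivity)]
      refine mul_le_mul_of_nonneg_left ?_ h0
      refine mul_le_of_le_one_right hz ?_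
      rw [Real.exp_le_one_iff]
      have : 0 ≤ 1 - α ^ 2 := by nlinarith [hα.1, hα.2]
      nlinarith [mul_nonneg this hz]
  intro a ha b hb hab
  have hee : ε b ≤ ε a := by
    rw [hε, hε]
    refine ciInf_mono ⟨0, ?_⟩ ?_
    · rintro _ ⟨θ, rfl⟩
      exact hnn b θ
    · intro θ
      refine integral_mono (hint b hb θ) (hint a ha θ) ?_
      intro x
      have hz : 0 ≤ ‖θhat x - (θ : EuclideanSpace ℝ (Fin d))‖ ^ 2 / σY ^ 2 := by positivity
      refine mul_le_mul_of_nonneg_left ?_ (hg θ x)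
      refine mul_le_mul_of_nonneg_left ?_ hz
      rw [Real.exp_le_exp]
      have : 0 ≤ a ^ 2 - b ^ 2 := by nlinarith [ha.1, ha.2, hb.1, hb.2]
      nlinarith [mul_nonneg this hz]
  obtain ⟨hx, hpx⟩ := root_facts d (ε a) a (τ a) (k a) hd0 (hεnn a) ha (hτ a) (hk a)
  obtain ⟨hy, hpy⟩ := root_facts d (ε b) b (τ b) (k b) hd0 (hεnn b) hb (hτ b) (hk b)
  rw [hτ] at hpx hpy
  exact root_mono d (ε a) (ε b) a b (k a) (k b) hd0 (hεnn b) hee ha.1 hb.2 hab hx hy hpx hpy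
end

section
/- For r > 0, define g(r) = (1 − (1 + r/4)^{-1})/(1 − (1 + r/2)^{-1/2}), which is the ratio of the Hellinger (α = 0) risk of the plug-in density N₂(X, σ_Y² I₂) to that of the optimally expanded density N₂(X, (1 + r/2)σ_Y² I₂) in dimension d = 2 with r = σ_X²/σ_Y². Then g(r) = (2 + r + √(4 + 2r))/(4 + r) for all r > 0; moreover g is strictly increasing on (0, 4(1+√2)), strictly decreasing on (4(1+√2), ∞), tends to 1 as r → 0⁺ and as r → ∞, and attains its maximum value (1+√2)/2 at r = 4(1+√2). -/
open Real Filter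

theorem stmt19 (g : ℝ → ℝ)
    (hg : ∀ r : ℝ, g r =
      (1 - (1 + r / 4)⁻¹) / (1 - (1 + r / 2) ^ (-(1 : ℝ) / 2))) :
    (∀ r : ℝ, 0 < r → g r = (2 + r + Real.sqrt (4 + 2 * r)) / (4 + r)) ∧
    StrictMonoOn g (Set.Ioo 0 (4 * (1 + Real.sqrt 2))) ∧
    StrictAntiOn g (Set.Ioi (4 * (1 + Real.sqrt 2))) ∧
    Tendsto g (nhdsWithin 0 (Set.Ioi 0)) (nhds 1) ∧
    Tendsto g atTop (nhds 1) ∧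
    g (4 * (1 + Real.sqrt 2)) = (1 + Real.sqrt 2) / 2 ∧
    (∀ r : ℝ, 0 < r → g r ≤ (1 + Real.sqrt 2) / 2) := by
  have h2 : Real.sqrt 2 ^ 2 = 2 := Real.sq_sqrt (by norm_num)
  have h2p : 0 < Real.sqrt 2 := Real.sqrt_pos.mpr (by norm_num)
  have hs1 : ∀ r : ℝ, 0 < r → 1 < Real.sqrt (1 + r / 2) := fun r hr => by
    rw [Real.lt_sqrt (by norm_num)]; linarith
  have hsq : ∀ r : ℝ, 0 < r → Real.sqrt (1 + r / 2) ^ 2 = 1 + r / 2 := fun r hr =>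
    Real.sq_sqrt (by linarith)
  have hh : ∀ r : ℝ, 0 < r → g r =
      1 + (Real.sqrt (1 + r / 2) - 1) / (Real.sqrt (1 + r / 2) ^ 2 + 1) := fun r hr => by
    have e : (1 + r / 2) ^ (-(1 : ℝ) / 2) = (Real.sqrt (1 + r / 2))⁻¹ := by
      rw [Real.sqrt_eq_rpow, ← Real.rpow_neg (by linarith)]; norm_num
    rw [hg, e]
    have a := hs1 r hr
    have b := hsq r hr
    generalize Real.sqrt (1 + r / 2) = s at a b
    have hr' : r = 2 * (s ^ 2 - 1) := by linarith
    subst hr'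
    have h1 : 1 - (1 + 2 * (s ^ 2 - 1) / 4)⁻¹ = (s ^ 2 - 1) / (s ^ 2 + 1) := by
      have : 1 + 2 * (s ^ 2 - 1) / 4 = (s ^ 2 + 1) / 2 := by ring
      rw [this]
      have : s ^ 2 + 1 ≠ 0 := by positivity
      field_simp; ring
    have h3 : 1 - s⁻¹ = (s - 1) / s := by field_simp
    rw [h1, h3]
    have : s ^ 2 + 1 ≠ 0 := by positivity
    have : s - 1 ≠ 0 := by linarith
    have : s ≠ 0 := by linarith
    field_simp
    ring
  have hcl : ∀ r : ℝ, 0 < r → g r = (2 + r + Real.sqrt (4 + 2 * r)) / (4 + r) := fun r hr => by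
    have e : Real.sqrt (4 + 2 * r) = 2 * Real.sqrt (1 + r / 2) := by
      rw [show 4 + 2 * r = 2 ^ 2 * (1 + r / 2) by ring, Real.sqrt_mul (by norm_num),
        Real.sqrt_sq (by norm_num)]
    rw [hh r hr, e]
    have b := hsq r hr
    rw [b]
    have : 1 + r / 2 + 1 ≠ 0 := by linarith
    have : 4 + r ≠ 0 := by linarith
    field_simp
    ring
  have hroot : Real.sqrt (1 + 4 * (1 + Real.sqrt 2) / 2) = 1 + Real.sqrt 2 := by
    rw [show 1 + 4 * (1 + Real.sqrt 2) / 2 = (1 + Real.sqrt 2) ^ 2 by nlinarith]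
    exact Real.sqrt_sq (by linarith)
  have hmax : g (4 * (1 + Real.sqrt 2)) = (1 + Real.sqrt 2) / 2 := by
    rw [hh _ (by linarith), hroot]
    have : (1 + Real.sqrt 2) ^ 2 + 1 ≠ 0 := by positivity
    field_simp
    nlinarith
  refine ⟨hcl, ?_, ?_, ?_, ?_, hmax, ?_⟩
  · intro x hx y hy hxy
    rw [hh x hx.1, hh y hy.1]
    have a := hs1 x hx.1
    have b : Real.sqrt (1 + x / 2) < Real.sqrt (1 + y / 2) :=
      Real.sqrt_lt_sqrt (by linarith [hx.1]) (by linarith)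
    have c : Real.sqrt (1 + y / 2) < 1 + Real.sqrt 2 := by
      rw [← hroot]
      exact Real.sqrt_lt_sqrt (by linarith [hy.1]) (by linarith [hy.2])
    generalize Real.sqrt (1 + x / 2) = s at *
    generalize Real.sqrt (1 + y / 2) = t at *
    have k : (s - 1) * (t - 1) < 2 := by nlinarith
    have := mul_pos (sub_pos.2 b) (sub_pos.2 k)
    rw [add_lt_add_iff_left, div_lt_div_iff₀ (by positivity) (by positivity)]
    nlinarith
  · intro x hx y hy hxy
    have hx' : 4 * (1 + Real.sqrt 2) < x := hx
    have hx0 : 0 < x := by linarith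
    rw [hh x hx0, hh y (by linarith)]
    have b : Real.sqrt (1 + x / 2) < Real.sqrt (1 + y / 2) :=
      Real.sqrt_lt_sqrt (by linarith) (by linarith)
    have c : 1 + Real.sqrt 2 < Real.sqrt (1 + x / 2) := by
      rw [← hroot]
      exact Real.sqrt_lt_sqrt (by linarith) (by linarith)
    generalize Real.sqrt (1 + x / 2) = s at *
    generalize Real.sqrt (1 + y / 2) = t at *
    have k : 2 < (s - 1) * (t - 1) := by nlinarith
    have := mul_pos (sub_pos.2 b) (sub_pos.2 k)
    rw [add_lt_add_iff_left, div_lt_div_iff₀ (by positivity) (by positivity)]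
    nlinarith
  · have hc : ContinuousAt (fun r : ℝ =>
        1 + (Real.sqrt (1 + r / 2) - 1) / (Real.sqrt (1 + r / 2) ^ 2 + 1)) 0 := by
      apply Continuous.continuousAt
      refine continuous_const.add (Continuous.div (by fun_prop) (by fun_prop) ?_)
      intro r; positivity
    have ht := hc.tendsto.mono_left (nhdsWithin_le_nhds (s := Set.Ioi 0))
    simp only [zero_div, add_zero, Real.sqrt_one, sub_self] at ht
    refine ht.congr' ?_
    filter_upwards [self_mem_nhdsWithin] with r hr
    exact (hh r hr).symm
  · have hT : Tendsto (fun r : ℝ => Real.sqrt (1 + r / 2)) atTop atTop :=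
      Real.tendsto_sqrt_atTop.comp
        (tendsto_atTop_add_const_left _ _ (tendsto_id.atTop_div_const (by norm_num)))
    have hu : Tendsto (fun r : ℝ => 1 + (Real.sqrt (1 + r / 2))⁻¹) atTop (nhds 1) := by
      simpa using (tendsto_inv_atTop_zero.comp hT).const_add 1
    refine tendsto_of_tendsto_of_tendsto_of_le_of_le' tendsto_const_nhds hu ?_ ?_
    · filter_upwards [eventually_gt_atTop 0] with r hr
      rw [hh r hr]
      have := hs1 r hr
      have : 0 ≤ (Real.sqrt (1 + r / 2) - 1) / (Real.sqrt (1 + r / 2) ^ 2 + 1) :=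
        div_nonneg (by linarith) (by positivity)
      linarith
    · filter_upwards [eventually_gt_atTop 0] with r hr
      rw [hh r hr]
      have := hs1 r hr
      rw [add_le_add_iff_left, inv_eq_one_div, div_le_div_iff₀ (by positivity) (by linarith)]
      nlinarith
  · intro r hr
    rw [hh r hr]
    have a := hs1 r hr
    generalize Real.sqrt (1 + r / 2) = s at *
    have : (s - 1) / (s ^ 2 + 1) ≤ (Real.sqrt 2 - 1) / 2 := by
      rw [div_le_div_iff₀ (by positivity) (by norm_num)]
      nlinarith [mul_nonneg (show 0 ≤ Real.sqrt 2 - 1 by nlinarith)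
        (sq_nonneg (s - 1 - Real.sqrt 2))]
    linarith
end
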